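/- arXiv:2106.09913 — 5 statements merged into one kernel-verified Lean document; each statement's English description precedes it below -/
import Mathlib

section
/- Let 1 ≤ E ≤ d_s. If μ_2^1, …, μ_2^E ∈ ℝ^{d_s} are linearly independent and Σ_2^1, …, Σ_2^E ∈ ℝ^{d_s×d_s} are positive definite matrices, then there exists u_s ∈ ℝ^{d_s} with ‖u_s‖_2 > 0 such that u_sᵀ Σ_2^e u_s = u_sᵀ μ_2^e for all e ∈ {1,…,E}. -/
open Matrix

namespace MvPolynomial

variable {σ k : Type*} [CommRing k]

/-- `p` is the monomial with exponent `γ` plus terms of strictly smaller total degree. -/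
def HasLeadMonomial (p : MvPolynomial σ k) (γ : σ →₀ ℕ) : Prop :=
  p - monomial γ 1 ∈ restrictSupport k {m : σ →₀ ℕ | m.degree < γ.degree}

theorem HasLeadMonomial.mul {p q : MvPolynomial σ k} {γ δ : σ →₀ ℕ}
    (hp : HasLeadMonomial p γ) (hq : HasLeadMonomial q δ) : HasLeadMonomial (p * q) (γ + δ) := by
  have hq' : q ∈ restrictSupport k {m : σ →₀ ℕ | m.degree ≤ δ.degree} := by
    rw [← sub_add_cancel q (monomial δ 1)]
    refine add_mem (restrictSupport_mono k (fun m hm => ?_) hq)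
      ((monomial_mem_restrictSupport k).2 (.inl (by simp)))
    simp only [Set.mem_ofPred_eq] at *
    omega
  have hγ : monomial γ (1 : k) ∈ restrictSupport k {m : σ →₀ ℕ | m.degree ≤ γ.degree} :=
    (monomial_mem_restrictSupport k).2 (.inl (by simp))
  have e : p * q - monomial (γ + δ) 1 =
      (p - monomial γ 1) * q + monomial γ 1 * (q - monomial δ 1) := by
    rw [← mul_one (1 : k), ← monomial_mul, mul_one]
    ring
  unfold HasLeadMonomial
  rw [e]
  refine add_mem ?_ ?_
  · refine restrictSupport_mono k ?_ ((restrictSupport_add k _ _).ge (Submodule.mul_mem_mul hp hq'))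
    rintro _ ⟨a, ha, b, hb, rfl⟩
    simp only [Set.mem_ofPred_eq, map_add] at *
    omega
  · refine restrictSupport_mono k ?_ ((restrictSupport_add k _ _).ge (Submodule.mul_mem_mul hγ hq))
    rintro _ ⟨a, ha, b, hb, rfl⟩
    simp only [Set.mem_ofPred_eq, map_add] at *
    omega

theorem hasLeadMonomial_monomial (γ : σ →₀ ℕ) :
    HasLeadMonomial (monomial γ (1 : k)) γ := by
  simp [HasLeadMonomial]

theorem hasLeadMonomial_one : HasLeadMonomial (1 : MvPolynomial σ k) 0 :=
  hasLeadMonomial_monomial 0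

theorem HasLeadMonomial.pow {p : MvPolynomial σ k} {γ : σ →₀ ℕ} (hp : HasLeadMonomial p γ)
    (n : ℕ) : HasLeadMonomial (p ^ n) (n • γ) := by
  induction n with
  | zero => simpa using hasLeadMonomial_one
  | succ n ih => simpa only [pow_succ, succ_nsmul] using ih.mul hp

theorem HasLeadMonomial.prod {ι : Type*} (s : Finset ι) {p : ι → MvPolynomial σ k}
    {γ : ι → σ →₀ ℕ} (hp : ∀ i, HasLeadMonomial (p i) (γ i)) :
    HasLeadMonomial (∏ i ∈ s, p i) (∑ i ∈ s, γ i) := by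
  classical
  induction s using Finset.induction_on with
  | empty => simpa using hasLeadMonomial_one
  | insert a s ha ih => simpa only [Finset.prod_insert ha, Finset.sum_insert ha] using (hp a).mul ih

theorem exists_mem_restrictSupport_degree_lt (p : MvPolynomial σ k) :
    ∃ n, p ∈ restrictSupport k {m : σ →₀ ℕ | m.degree < n} := by
  refine ⟨p.support.sup (fun m => m.degree) + 1, (mem_restrictSupport_iff k).2 fun m hm => ?_⟩
  exact Nat.lt_succ_of_le (Finset.le_sup (f := fun m : σ →₀ ℕ => m.degree) hm)

theorem bijective_of_hasLeadMonomial {T : MvPolynomial σ k →ₗ[k] MvPolynomial σ k}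
    (hT : ∀ γ, HasLeadMonomial (T (monomial γ 1)) γ) : Function.Bijective T := by
  have key : ∀ n, ∀ p ∈ restrictSupport k {m : σ →₀ ℕ | m.degree < n + 1},
      T p - p ∈ restrictSupport k {m : σ →₀ ℕ | m.degree < n} := by
    intro n p hp
    rw [restrictSupport_eq_span] at hp
    induction hp using Submodule.span_induction with
    | mem x hx =>
      obtain ⟨γ, hγ, rfl⟩ := hx
      refine restrictSupport_mono k (fun m hm => ?_) (hT γ)
      simp only [Set.mem_ofPred_eq] at *
      omega
    | zero => simp
    | add x y _ _ hx hy =>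
      rw [map_add, add_sub_add_comm]
      exact add_mem hx hy
    | smul a x _ hx =>
      rw [map_smul, ← smul_sub]
      exact Submodule.smul_mem _ _ hx
  constructor
  · rw [← LinearMap.ker_eq_bot, LinearMap.ker_eq_bot']
    intro p hp
    obtain ⟨n, hn⟩ := exists_mem_restrictSupport_degree_lt p
    induction n with
    | zero => simpa [mem_restrictSupport_iff] using hn
    | succ n ih => exact ih (by simpa [hp] using key n p hn)
  · intro p
    obtain ⟨n, hn⟩ := exists_mem_restrictSupport_degree_lt p
    induction n generalizing p with
    | zero => exact ⟨0, by simp_all [mem_restrictSupport_iff]⟩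
    | succ n ih =>
      obtain ⟨q, hq⟩ := ih _ (key n p hn)
      exact ⟨p - q, by rw [map_sub, hq]; ring⟩

variable [Fintype σ]

/-- The linear endomorphism replacing each power `X i ^ (d * q + r)`, `r < d`, occurring in a
monomial by `X i ^ r * g i ^ q`. -/
noncomputable def divModMap (d : ℕ) (g : σ → MvPolynomial σ k) :
    MvPolynomial σ k →ₗ[k] MvPolynomial σ k :=
  (basisMonomials σ k).constr k fun γ => ∏ i, X i ^ (γ i % d) * g i ^ (γ i / d)

theorem divModMap_monomial (d : ℕ) (g : σ → MvPolynomial σ k) (γ : σ →₀ ℕ) :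
    divModMap d g (monomial γ 1) = ∏ i, X i ^ (γ i % d) * g i ^ (γ i / d) := by
  have h := Module.Basis.constr_basis (basisMonomials σ k) k
    (fun γ : σ →₀ ℕ => ∏ i, X i ^ (γ i % d) * g i ^ (γ i / d)) γ
  rwa [coe_basisMonomials] at h

theorem divModMap_bijective {d : ℕ} {g : σ → MvPolynomial σ k}
    (hg : ∀ i, HasLeadMonomial (g i) (Finsupp.single i d)) :
    Function.Bijective (divModMap d g) := by
  refine bijective_of_hasLeadMonomial fun γ => ?_
  rw [divModMap_monomial]
  have h := HasLeadMonomial.prod (k := k) Finset.univ fun i =>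
    ((hasLeadMonomial_monomial (Finsupp.single i 1)).pow (γ i % d)).mul ((hg i).pow (γ i / d))
  convert h using 1
  · rfl
  · classical
    ext j
    simp [Finsupp.single_apply, Finset.sum_add_distrib, Nat.mod_add_div']

theorem divModMap_mul_monomial {d : ℕ} (hd : 0 < d) (g : σ → MvPolynomial σ k) (j : σ)
    (γ : σ →₀ ℕ) :
    divModMap d g (monomial (γ + Finsupp.single j d) 1) = g j * divModMap d g (monomial γ 1) := by
  classical
  rw [divModMap_monomial, divModMap_monomial, ← Finset.mul_prod_erase _ _ (Finset.mem_univ j),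
    ← Finset.mul_prod_erase _ (fun i => X i ^ (γ i % d) * g i ^ (γ i / d)) (Finset.mem_univ j)]
  have : ∀ i ∈ Finset.univ.erase j, X i ^ ((γ + Finsupp.single j d) i % d) *
      g i ^ ((γ + Finsupp.single j d) i / d) = X i ^ (γ i % d) * g i ^ (γ i / d) := by
    intro i hi
    simp [Finsupp.single_eq_of_ne (Finset.ne_of_mem_erase hi)]
  rw [Finset.prod_congr rfl this]
  simp only [Finsupp.add_apply, Finsupp.single_eq_same, Nat.add_mod_right,
    Nat.add_div_right _ hd, pow_succ]
  ring

/-- The coefficients of the monomials all of whose exponents are smaller than `d`. -/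
noncomputable def smallCoeffs (σ k : Type*) [CommRing k] [Fintype σ] (d : ℕ) :
    MvPolynomial σ k →ₗ[k] ((σ → Fin d) → k) :=
  LinearMap.pi fun α => lcoeff k (Finsupp.equivFunOnFinite.symm fun i => (α i : ℕ))

theorem smallCoeffs_surjective (d : ℕ) : Function.Surjective (smallCoeffs σ k d) := by
  intro f
  classical
  refine ⟨∑ α, monomial (Finsupp.equivFunOnFinite.symm fun i => (α i : ℕ)) (f α), ?_⟩
  ext β
  have h : ∀ α : σ → Fin d, (Finsupp.equivFunOnFinite.symm fun i => (α i : ℕ)) =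
      Finsupp.equivFunOnFinite.symm (fun i => (β i : ℕ)) ↔ α = β := by
    intro α
    rw [Finsupp.equivFunOnFinite.symm.injective.eq_iff]
    exact ⟨fun h => _root_.funext fun i => Fin.ext (congrFun h i), fun h => h ▸ rfl⟩
  simp [smallCoeffs, coeff_monomial, h]

theorem mem_ker_smallCoeffs {d : ℕ} {p : MvPolynomial σ k} :
    p ∈ (smallCoeffs σ k d).ker ↔ p ∈ restrictSupport k {m : σ →₀ ℕ | ∃ i, d ≤ m i} := by
  rw [mem_restrictSupport_iff, LinearMap.mem_ker]
  constructor
  · intro h m hm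
    by_contra! hlt
    simp only [Set.mem_ofPred_eq, not_exists, not_le] at hlt
    refine mem_support_iff.1 hm ?_
    have := congrFun h fun i => ⟨m i, hlt i⟩
    simpa [smallCoeffs] using this
  · intro h
    ext α
    by_contra hne
    obtain ⟨i, hi⟩ := h (mem_support_iff.2 hne)
    exact absurd hi (by simp)

theorem map_divModMap_ker_smallCoeffs {d : ℕ} (hd : 0 < d) {g : σ → MvPolynomial σ k}
    (hg : ∀ i, HasLeadMonomial (g i) (Finsupp.single i d)) :
    (smallCoeffs σ k d).ker.map (divModMap d g) =
      (Ideal.span (Set.range g)).restrictScalars k := by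
  have hJ : (smallCoeffs σ k d).ker = restrictSupport k {m : σ →₀ ℕ | ∃ i, d ≤ m i} :=
    Submodule.ext fun p => mem_ker_smallCoeffs
  rw [hJ]
  apply le_antisymm
  · rw [restrictSupport_eq_span, Submodule.map_span, Submodule.span_le]
    rintro _ ⟨_, ⟨γ, ⟨i, hi⟩, rfl⟩, rfl⟩
    have e : γ = (γ - Finsupp.single i d) + Finsupp.single i d :=
      (tsub_add_cancel_of_le (by simpa using hi)).symm
    rw [e, divModMap_mul_monomial hd]
    exact Ideal.mul_mem_right _ _ (Ideal.subset_span ⟨i, rfl⟩)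
  · have hmul : ∀ i q, g i * divModMap d g q ∈
        (restrictSupport k {m : σ →₀ ℕ | ∃ i, d ≤ m i}).map (divModMap d g) := by
      intro i q
      induction q using MvPolynomial.induction_on' with
      | monomial γ a =>
        refine ⟨a • monomial (γ + Finsupp.single i d) 1, Submodule.smul_mem _ _
          ((monomial_mem_restrictSupport k).2 (.inl ⟨i, by simp⟩)), ?_⟩
        rw [map_smul, divModMap_mul_monomial hd, ← mul_smul_comm, ← map_smul, smul_monomial,
          smul_eq_mul, mul_one]
      | add p q hp hq =>
        rw [map_add, mul_add]
        exact add_mem hp hq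
    intro p hp
    rw [Submodule.restrictScalars_mem, Ideal.mem_span_range_iff_exists_fun] at hp
    obtain ⟨c, rfl⟩ := hp
    refine sum_mem fun i _ => ?_
    obtain ⟨q, hq⟩ := (divModMap_bijective hg).2 (c i)
    rw [← hq, mul_comm]
    exact hmul i q

theorem nonempty_quotient_equiv {d : ℕ} (hd : 0 < d) {g : σ → MvPolynomial σ k}
    (hg : ∀ i, HasLeadMonomial (g i) (Finsupp.single i d)) :
    Nonempty ((MvPolynomial σ k ⧸ Ideal.span (Set.range g)) ≃ₗ[k] ((σ → Fin d) → k)) := by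
  let T := LinearEquiv.ofBijective _ (divModMap_bijective hg)
  exact ⟨(Submodule.Quotient.restrictScalarsEquiv k _).symm ≪≫ₗ
    (Submodule.Quotient.equiv _ _ T (map_divModMap_ker_smallCoeffs hd hg)).symm ≪≫ₗ
    (smallCoeffs σ k d).quotKerEquivOfSurjective (smallCoeffs_surjective d)⟩

end MvPolynomial

theorem even_finrank_of_field {K : Type*} [Field K] [Algebra ℝ K] [FiniteDimensional ℝ K]
    (h : IsEmpty (K →ₐ[ℝ] ℝ)) : Even (Module.finrank ℝ K) := by
  rcases Real.nonempty_algEquiv_or K with ⟨⟨e⟩⟩ | ⟨⟨e⟩⟩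
  · exact (h.false e.toAlgHom).elim
  · rw [e.toLinearEquiv.finrank_eq, Complex.finrank_real_complex]
    exact even_two

theorem nonempty_algHom_real_of_odd_finrank {A : Type*} [CommRing A] [Algebra ℝ A]
    [FiniteDimensional ℝ A] (hodd : Odd (Module.finrank ℝ A)) : Nonempty (A →ₐ[ℝ] ℝ) := by
  by_contra hne
  rw [not_nonempty_iff] at hne
  have : IsArtinianRing A := IsArtinianRing.of_finite ℝ A
  have key := IsNoetherianRing.induction_on_isQuotientEquivQuotientPrime A (M := A) inferInstance
    (motive := fun N _ _ _ =>
      let _ := Module.compHom N (algebraMap ℝ A); Even (Module.finrank ℝ N)) ?_ ?_ ?_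
  · refine Nat.not_even_iff_odd.2 hodd ?_
    convert key using 1
    congr 1
    refine Module.ext' _ _ fun r x => ?_
    exact Algebra.smul_def r x
  · intro N _ _ _ _
    let _ := Module.compHom N (algebraMap ℝ A)
    simp [Module.finrank_zero_of_subsingleton]
  · intro N _ _ _ p f
    let _ := Module.compHom N (algebraMap ℝ A)
    have : IsScalarTower ℝ A N := IsScalarTower.of_algebraMap_smul fun r x => rfl
    have : p.1.IsMaximal := inferInstance
    let _ := Ideal.Quotient.field p.1
    have e := (f.restrictScalars ℝ).finrank_eq
    change Even (Module.finrank ℝ N)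
    rw [e]
    refine even_finrank_of_field ⟨fun φ => hne.false (φ.comp (Ideal.Quotient.mkₐ ℝ p.1))⟩
  · intro N₁ _ _ _ N₂ _ _ _ N₃ _ _ _ f g hf hg hfg h₁ h₃
    let _ := Module.compHom N₁ (algebraMap ℝ A)
    let _ := Module.compHom N₂ (algebraMap ℝ A)
    let _ := Module.compHom N₃ (algebraMap ℝ A)
    have : IsScalarTower ℝ A N₁ := IsScalarTower.of_algebraMap_smul fun r x => rfl
    have : IsScalarTower ℝ A N₂ := IsScalarTower.of_algebraMap_smul fun r x => rfl
    have : IsScalarTower ℝ A N₃ := IsScalarTower.of_algebraMap_smul fun r x => rfl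
    have : FiniteDimensional ℝ N₂ := Module.Finite.trans A N₂
    change Even (Module.finrank ℝ N₂)
    have e := (g.restrictScalars ℝ).finrank_range_add_finrank_ker
    have hr : (g.restrictScalars ℝ).range = ⊤ := LinearMap.range_eq_top.2 hg
    have hk : (g.restrictScalars ℝ).ker = (f.restrictScalars ℝ).range :=
      LinearMap.exact_iff.1 hfg
    rw [hr, hk, finrank_top, LinearMap.finrank_range_of_inj (f := f.restrictScalars ℝ) hf] at e
    rw [← e]
    exact h₃.add h₁

theorem exists_algHom_ne_of_even_finrank {A : Type*} [CommRing A] [Algebra ℝ A]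
    [FiniteDimensional ℝ A] (heven : Even (Module.finrank ℝ A)) (φ : A →ₐ[ℝ] ℝ)
    (hφ : IsIdempotentElem (RingHom.ker φ)) : ∃ ψ : A →ₐ[ℝ] ℝ, ψ ≠ φ := by
  have : IsNoetherianRing A := have := IsArtinianRing.of_finite ℝ A; inferInstance
  obtain ⟨e, he, hker⟩ := (Ideal.isIdempotentElem_iff_of_fg _
    (IsNoetherian.noetherian (RingHom.ker φ))).1 hφ
  have hmem : ∀ x, φ x = 0 ↔ ∃ a, a * e = x := by
    intro x
    rw [← RingHom.mem_ker, hker, Submodule.mem_span_singleton]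
    rfl
  let m : A →ₗ[ℝ] A := LinearMap.mulLeft ℝ e
  have h1 : Module.finrank ℝ m.range + 1 = Module.finrank ℝ A := by
    have hr : m.range = φ.toLinearMap.ker := by
      ext x
      simp [m, hmem, mul_comm]
    have := φ.toLinearMap.finrank_range_add_finrank_ker
    rw [hr, ← this, LinearMap.range_eq_top.2, finrank_top, Module.finrank_self, add_comm]
    exact fun r => ⟨algebraMap ℝ A r, by simp⟩
  have hk : m.ker = (Ideal.span {1 - e}).restrictScalars ℝ := by
    ext x
    simp only [m, LinearMap.mem_ker, LinearMap.mulLeft_apply, Submodule.restrictScalars_mem,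
      Ideal.mem_span_singleton]
    constructor
    · exact fun h => ⟨x, by linear_combination h⟩
    · rintro ⟨y, rfl⟩
      linear_combination -y * he.eq
  have h2 : Module.finrank ℝ (A ⧸ Ideal.span {1 - e}) = Module.finrank ℝ m.range := by
    rw [← m.quotKerEquivRange.finrank_eq, hk]
    exact (Submodule.Quotient.restrictScalarsEquiv ℝ (Ideal.span {1 - e})).symm.finrank_eq
  obtain ⟨ψ⟩ := nonempty_algHom_real_of_odd_finrank (A := A ⧸ Ideal.span {1 - e}) (by
    rw [h2]; rw [← h1] at heven; exact Nat.not_even_iff_odd.1 fun h => by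
      simp [Nat.even_add_one, h] at heven)
  refine ⟨ψ.comp (Ideal.Quotient.mkₐ ℝ _), fun h => ?_⟩
  have h0 : φ e = 0 := (hmem e).2 ⟨1, one_mul e⟩
  have h3 : Ideal.Quotient.mkₐ ℝ (Ideal.span {1 - e}) (1 - e) = 0 :=
    Ideal.Quotient.eq_zero_iff_mem.2 (Ideal.mem_span_singleton_self _)
  have h4 : φ (1 - e) = 0 := by rw [← h, AlgHom.comp_apply, h3, map_zero]
  simp [h0] at h4

namespace MvPolynomial

theorem mem_idealOfVars_of_aeval_zero {σ k : Type*} [CommRing k] {p : MvPolynomial σ k}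
    (hp : aeval (0 : σ → k) p = 0) : p ∈ idealOfVars σ k := by
  rw [← pow_one (idealOfVars σ k), mem_pow_idealOfVars_iff']
  intro m hm
  obtain rfl : m = 0 := by
    rw [← Finsupp.degree_eq_zero_iff]
    omega
  simpa [aeval_zero, constantCoeff_eq] using hp

/-- A square real polynomial system with leading terms `X i ^ d`, `d` even, for which the origin is
a simple zero, has another real zero. -/
theorem exists_ne_zero_forall_eval_eq_zero {σ : Type*} [Fintype σ] [Nonempty σ] {d : ℕ}
    (hd : 0 < d) (hd' : Even d) {g : σ → MvPolynomial σ ℝ}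
    (hg : ∀ i, HasLeadMonomial (g i) (Finsupp.single i d))
    (hg₀ : ∀ i, aeval (0 : σ → ℝ) (g i) = 0)
    (hg₁ : ∀ i, ∃ q ∈ idealOfVars σ ℝ ^ 2, X i - q ∈ Ideal.span (Set.range g)) :
    ∃ y : σ → ℝ, y ≠ 0 ∧ ∀ i, eval y (g i) = 0 := by
  classical
  set I := Ideal.span (Set.range g) with hI
  obtain ⟨e⟩ := nonempty_quotient_equiv hd hg
  rw [← hI] at e
  have : FiniteDimensional ℝ (MvPolynomial σ ℝ ⧸ I) := Module.Finite.equiv e.symm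
  have heven : Even (Module.finrank ℝ (MvPolynomial σ ℝ ⧸ I)) := by
    rw [e.finrank_eq, Module.finrank_fintype_fun_eq_card, Fintype.card_fun, Fintype.card_fin]
    exact hd'.pow_of_ne_zero Fintype.card_ne_zero
  have hle : I ≤ RingHom.ker (aeval (0 : σ → ℝ)) := by
    rw [hI, Ideal.span_le]
    rintro _ ⟨i, rfl⟩
    exact hg₀ i
  let φ : (MvPolynomial σ ℝ ⧸ I) →ₐ[ℝ] ℝ := Ideal.Quotient.liftₐ I (aeval 0) fun p hp => hle hp
  have hφ : ∀ p, φ (Ideal.Quotient.mk I p) = aeval (0 : σ → ℝ) p := fun p => rfl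
  have hker : RingHom.ker φ = (idealOfVars σ ℝ).map (Ideal.Quotient.mk I) := by
    apply le_antisymm
    · intro x hx
      obtain ⟨p, rfl⟩ := Ideal.Quotient.mk_surjective x
      exact Ideal.mem_map_of_mem _ (mem_idealOfVars_of_aeval_zero hx)
    · rw [Ideal.map_le_iff_le_comap, Ideal.span_le]
      rintro _ ⟨i, rfl⟩
      change φ (Ideal.Quotient.mk I (X i)) = 0
      simp [hφ]
  have hidem : IsIdempotentElem (RingHom.ker φ) := by
    refine le_antisymm Ideal.mul_le_left ?_
    rw [hker, ← Ideal.map_mul, Ideal.map_le_iff_le_comap, Ideal.span_le]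
    rintro _ ⟨i, rfl⟩
    obtain ⟨q, hq, hqi⟩ := hg₁ i
    rw [SetLike.mem_coe, Ideal.mem_comap, Ideal.Quotient.eq.2 hqi, ← pow_two]
    exact Ideal.mem_map_of_mem _ hq
  obtain ⟨ψ, hψ⟩ := exists_algHom_ne_of_even_finrank heven φ hidem
  have hcomp : ψ.comp (Ideal.Quotient.mkₐ ℝ I) =
      aeval fun i => ψ (Ideal.Quotient.mk I (X i)) := by
    ext i
    simp
  refine ⟨fun i => ψ (Ideal.Quotient.mk I (X i)), fun h => hψ ?_, fun i => ?_⟩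
  · refine Ideal.Quotient.algHom_ext ℝ ?_
    rw [hcomp, h]
    rfl
  · have h := DFunLike.congr_fun hcomp (g i)
    rw [AlgHom.comp_apply, Ideal.Quotient.mkₐ_eq_mk,
      Ideal.Quotient.eq_zero_iff_mem.2 (hI ▸ Ideal.subset_span (Set.mem_range_self i)), map_zero] at h
    rw [← coe_aeval_eq_eval]
    exact h.symm

end MvPolynomial

open MvPolynomial in
theorem exists_ne_zero_quartic_perturbation {σ : Type*} [Fintype σ] [Nonempty σ]
    (S : σ → Matrix σ σ ℝ) {a : ℝ} (ha : a ≠ 0) :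
    ∃ y : σ → ℝ, y ≠ 0 ∧ ∀ i, y i ^ 4 + a * (y ⬝ᵥ (S i *ᵥ y) - y i) = 0 := by
  let Q : σ → MvPolynomial σ ℝ := fun i => ∑ j, ∑ l, C (S i j l) * (X j * X l)
  let g : σ → MvPolynomial σ ℝ := fun i => X i ^ 4 + C a * (Q i - X i)
  have hX : ∀ i, (X i : MvPolynomial σ ℝ) ∈ idealOfVars σ ℝ := fun i => Ideal.subset_span ⟨i, rfl⟩
  have hQ : ∀ i, Q i ∈ idealOfVars σ ℝ ^ 2 := fun i =>
    sum_mem fun j _ => sum_mem fun l _ => Ideal.mul_mem_left _ _ <| by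
      rw [pow_two]
      exact Ideal.mul_mem_mul (hX j) (hX l)
  have hlead : ∀ i, HasLeadMonomial (g i) (Finsupp.single i 4) := by
    intro i
    have e : g i - monomial (Finsupp.single i 4) 1 = a • (Q i - X i) := by
      simp [g, X_pow_eq_monomial, C_mul']
    rw [HasLeadMonomial, e]
    refine Submodule.smul_mem _ _ (Submodule.sub_mem _ (Submodule.sum_mem _ fun j _ =>
      Submodule.sum_mem _ fun l _ => ?_) ?_)
    · rw [C_mul', X, X, monomial_mul]
      refine Submodule.smul_mem _ _ ((monomial_mem_restrictSupport ℝ).2 (.inl ?_))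
      simp
    · exact (monomial_mem_restrictSupport ℝ).2 (.inl (by simp))
  obtain ⟨y, hy, hgy⟩ := exists_ne_zero_forall_eval_eq_zero (by norm_num) (by decide) hlead
    (fun i => by simp [g, Q]) fun i => by
      refine ⟨C a⁻¹ * X i ^ 4 + Q i, add_mem (Ideal.mul_mem_left _ _ ?_) (hQ i), ?_⟩
      · exact Ideal.pow_le_pow_right (by norm_num) (Ideal.pow_mem_pow (hX i) 4)
      · have e : X i - (C a⁻¹ * X i ^ 4 + Q i) = -C a⁻¹ * g i := by
          have : C a⁻¹ * C a = (1 : MvPolynomial σ ℝ) := by rw [← C_mul, inv_mul_cancel₀ ha, C_1]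
          simp only [g]
          linear_combination (X i - Q i) * (-this)
        rw [e]
        exact Ideal.mul_mem_left _ _ (Ideal.subset_span ⟨i, rfl⟩)
  refine ⟨y, hy, fun i => ?_⟩
  rw [← hgy i]
  simp only [g, Q, dotProduct, Matrix.mulVec, map_add, map_sub, map_mul, map_pow, map_sum, eval_X,
    eval_C, Finset.mul_sum]
  congr 3
  exact Finset.sum_congr rfl fun j _ => Finset.sum_congr rfl fun l _ => by ring

theorem exists_pos_mul_sq_norm_le {σ : Type*} [Fintype σ] {M : Matrix σ σ ℝ} (hM : M.PosDef) :
    ∃ c > 0, ∀ y : σ → ℝ, c * ‖y‖ ^ 2 ≤ y ⬝ᵥ (M *ᵥ y) := by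
  obtain ⟨c, hc, h⟩ := (isCompact_sphere (0 : σ → ℝ) 1).exists_forall_le'
    (f := fun y => y ⬝ᵥ (M *ᵥ y)) (a := 0) (by unfold dotProduct mulVec dotProduct; fun_prop)
    fun y hy => by
      have := hM.dotProduct_mulVec_pos (x := y) (ne_zero_of_mem_unit_sphere (⟨y, hy⟩ : Metric.sphere (0 : σ → ℝ) 1))
      simpa using this
  refine ⟨c, hc, fun y => ?_⟩
  rcases eq_or_ne y 0 with rfl | hy
  · simp
  have hy' : ‖y‖ ≠ 0 := norm_ne_zero_iff.2 hy
  have := h (‖y‖⁻¹ • y) (by simp [norm_smul, hy'])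
  simp only [smul_dotProduct, mulVec_smul, dotProduct_smul, smul_eq_mul] at this
  have h2 : ‖y‖⁻¹ * (‖y‖⁻¹ * y ⬝ᵥ (M *ᵥ y)) * ‖y‖ ^ 2 = y ⬝ᵥ (M *ᵥ y) := by field_simp
  rw [← h2]
  gcongr

theorem exists_le_mul_sq_norm {σ : Type*} [Fintype σ] (M : Matrix σ σ ℝ) :
    ∃ K, 0 ≤ K ∧ ∀ y : σ → ℝ, y ⬝ᵥ (M *ᵥ y) ≤ K * ‖y‖ ^ 2 := by
  refine ⟨∑ i, ∑ j, |M i j|, by positivity, fun y => ?_⟩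
  simp only [dotProduct, mulVec, Finset.mul_sum, Finset.sum_mul]
  refine Finset.sum_le_sum fun i _ => Finset.sum_le_sum fun j _ => (le_abs_self _).trans ?_
  rw [abs_mul, abs_mul, ← Real.norm_eq_abs (y i), ← Real.norm_eq_abs (y j)]
  have h1 := norm_le_pi_norm y i
  have h2 := norm_le_pi_norm y j
  calc ‖y i‖ * (|M i j| * ‖y j‖) ≤ ‖y‖ * (|M i j| * ‖y‖) := by gcongr
    _ = _ := by ring

theorem exists_ne_zero_dotProduct_mulVec_eq {σ : Type*} [Fintype σ] [Nonempty σ]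
    {S : σ → Matrix σ σ ℝ} (hS : ∀ i, (S i).PosDef) :
    ∃ y : σ → ℝ, y ≠ 0 ∧ ∀ i, y ⬝ᵥ (S i *ᵥ y) = y i := by
  obtain ⟨i₀⟩ := ‹Nonempty σ›
  have : Nonempty σ := ⟨i₀⟩
  obtain ⟨c, hc, hlow⟩ := exists_pos_mul_sq_norm_le (hS i₀)
  choose K hK hup using fun i => exists_le_mul_sq_norm (S i)
  set L := ∑ i, K i with hL
  have hL0 : 0 ≤ L := Finset.sum_nonneg fun i _ => hK i
  have hKL : ∀ i, K i ≤ L := fun i => Finset.single_le_sum (fun j _ => hK j) (Finset.mem_univ i)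
  set R := c⁻¹ with hR
  have hR0 : 0 < R := inv_pos.2 hc
  set r := (L + R ^ 2)⁻¹ with hr
  have hr0 : 0 < r := by positivity
  let s : Set (σ → ℝ) := Metric.closedBall 0 R ∩ {y | r ≤ ‖y‖}
  have hs : IsCompact s := (isCompact_closedBall 0 R).inter_right
    (isClosed_le continuous_const continuous_norm)
  have hpert : ∀ a : ℝ, 1 ≤ a → ∃ y ∈ s, ∀ i, |y ⬝ᵥ (S i *ᵥ y) - y i| ≤ R ^ 4 / a := by
    intro a ha
    have ha0 : 0 < a := by linarith
    obtain ⟨y, hy, hya⟩ := exists_ne_zero_quartic_perturbation S ha0.ne'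
    have hy0 : 0 < ‖y‖ := norm_pos_iff.2 hy
    have hyi : ∀ i, |y i| ≤ ‖y‖ := fun i => norm_le_pi_norm y i
    have hdiff : ∀ i, y ⬝ᵥ (S i *ᵥ y) - y i = -(y i ^ 4 / a) := by
      intro i
      field_simp
      linarith [hya i]
    have hyR : ‖y‖ ≤ R := by
      have h1 : c * ‖y‖ ^ 2 ≤ ‖y‖ := by
        have : 0 ≤ y i₀ ^ 4 / a := by positivity
        linarith [hlow y, hdiff i₀, le_abs_self (y i₀), hyi i₀]
      rw [hR, le_inv_comm₀ hy0 hc, ← one_div, le_div_iff₀ hy0]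
      nlinarith
    have hquart : ∀ i, y i ^ 4 ≤ ‖y‖ ^ 4 := fun i => by
      rw [← Even.pow_abs (by decide : Even 4)]
      gcongr
      exact hyi i
    have hyr : r ≤ ‖y‖ := by
      have hi : ∀ i, ‖y i‖ ≤ (L + R ^ 2) * ‖y‖ ^ 2 := by
        intro i
        have h0 : 0 ≤ y ⬝ᵥ (S i *ᵥ y) := by
          simpa using (hS i).posSemidef.dotProduct_mulVec_nonneg y
        have h1 : 0 ≤ y i ^ 4 / a := by positivity
        have h2 : y i ^ 4 / a ≤ ‖y‖ ^ 4 := (div_le_self (by positivity) ha).trans (hquart i)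
        have h3 : ‖y‖ ^ 4 ≤ R ^ 2 * ‖y‖ ^ 2 := by
          calc ‖y‖ ^ 4 = ‖y‖ ^ 2 * ‖y‖ ^ 2 := by ring
            _ ≤ R ^ 2 * ‖y‖ ^ 2 := by gcongr
        have h4 : K i * ‖y‖ ^ 2 ≤ L * ‖y‖ ^ 2 := by gcongr; exact hKL i
        rw [Real.norm_of_nonneg (by linarith [hdiff i])]
        linarith [hdiff i, hup i y]
      have h1 := (pi_norm_le_iff_of_nonneg (by positivity)).2 hi
      rw [hr, inv_le_comm₀ (by positivity) hy0, ← one_div, div_le_iff₀ hy0]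
      nlinarith
    refine ⟨y, ⟨by simpa using hyR, hyr⟩, fun i => ?_⟩
    rw [hdiff, abs_neg, abs_of_nonneg (by positivity)]
    have h1 : ‖y‖ ^ 4 ≤ R ^ 4 := by gcongr
    exact div_le_div_of_nonneg_right ((hquart i).trans h1) ha0.le
  obtain ⟨y₁, hy₁, -⟩ := hpert 1 le_rfl
  obtain ⟨y, hys, hmin⟩ := hs.exists_isMinOn ⟨y₁, hy₁⟩
    (f := fun y => ∑ i, |y ⬝ᵥ (S i *ᵥ y) - y i|) (by unfold dotProduct mulVec dotProduct; fun_prop)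
  refine ⟨y, norm_pos_iff.1 (hr0.trans_le hys.2), ?_⟩
  have hle : ∑ i, |y ⬝ᵥ (S i *ᵥ y) - y i| ≤ 0 := by
    have hlim : Filter.Tendsto (fun a : ℝ => Fintype.card σ * (R ^ 4 / a)) Filter.atTop (nhds 0) := by
      simpa using (Filter.tendsto_id.const_div_atTop (R ^ 4)).const_mul (Fintype.card σ : ℝ)
    refine ge_of_tendsto hlim ?_
    filter_upwards [Filter.eventually_ge_atTop 1] with a ha
    obtain ⟨z, hz, hza⟩ := hpert a ha
    refine (hmin hz).trans ((Finset.sum_le_sum fun i _ => hza i).trans_eq ?_)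
    simp
  intro i
  have := (Finset.sum_eq_zero_iff_of_nonneg fun i _ => abs_nonneg _).1
    (hle.antisymm (Finset.sum_nonneg fun i _ => abs_nonneg _)) i (Finset.mem_univ i)
  linarith [abs_eq_zero.1 this]

/-- IRM lower bound: if `1 ≤ E ≤ d_s`, the spurious means `μ_2^1, …, μ_2^E ∈ ℝ^{d_s}` are
linearly independent and the spurious covariances `Σ_2^1, …, Σ_2^E` are positive definite,
then there exists `u_s ∈ ℝ^{d_s}` with `‖u_s‖ > 0` (i.e. `u_s ≠ 0`) such that
`u_sᵀ Σ_2^e u_s = u_sᵀ μ_2^e` for all environments `e`. -/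
theorem irm_lower_bound {ds E : ℕ} (hE : 1 ≤ E) (hEds : E ≤ ds)
    (μ2 : Fin E → (Fin ds → ℝ)) (Sig2 : Fin E → Matrix (Fin ds) (Fin ds) ℝ)
    (hμ : LinearIndependent ℝ μ2) (hSig : ∀ e, (Sig2 e).PosDef) :
    ∃ u : Fin ds → ℝ, u ≠ 0 ∧ ∀ e, u ⬝ᵥ ((Sig2 e) *ᵥ u) = u ⬝ᵥ μ2 e := by
  have : Nonempty (Fin E) := ⟨⟨0, hE⟩⟩
  obtain ⟨N, hN⟩ : ∃ N : Matrix (Fin ds) (Fin E) ℝ, of μ2 * N = 1 := by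
    have hinj : Function.Injective (of μ2)ᵀ.mulVec := by
      rwa [mulVec_injective_iff]
    obtain ⟨f, hf⟩ := (toLin' (of μ2)ᵀ).exists_leftInverse_of_injective
      (LinearMap.ker_eq_bot.2 hinj)
    have hB : LinearMap.toMatrix' f * (of μ2)ᵀ = 1 := by
      rw [← LinearMap.toMatrix'_id, ← hf, LinearMap.toMatrix'_comp, LinearMap.toMatrix'_toLin']
    exact ⟨(LinearMap.toMatrix' f)ᵀ, by
      rw [← transpose_inj, transpose_mul, transpose_transpose, hB, transpose_one]⟩
  have hNinj : Function.Injective N.mulVec :=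
    Function.LeftInverse.injective (g := (of μ2).mulVec) fun x => by
      rw [mulVec_mulVec, hN, one_mulVec]
  obtain ⟨y, hy, h⟩ := exists_ne_zero_dotProduct_mulVec_eq fun e =>
    (hSig e).conjTranspose_mul_mul_same hNinj
  refine ⟨N *ᵥ y, fun h0 => hy (hNinj (by rw [h0, mulVec_zero])), fun e => ?_⟩
  have hμe : N *ᵥ y ⬝ᵥ μ2 e = y e := by
    rw [dotProduct_comm]
    change (of μ2 *ᵥ (N *ᵥ y)) e = y e
    rw [mulVec_mulVec, hN, one_mulVec]
  rw [hμe, ← h e, conjTranspose_eq_transpose_of_trivial, ← mulVec_mulVec, ← mulVec_mulVec,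
    dotProduct_mulVec y, vecMul_transpose]
end

section
/- Let r, d_s ≥ 1, σ_1, σ_2 > 0, μ_1 ∈ ℝ^r, μ_2 ∈ ℝ^{d_s}, and let β = (β_1, β_2) ∈ ℝ^r × ℝ^{d_s} satisfy ‖β_1‖_2² + ‖β_2‖_2² = 1. Set ψ = √(σ_1² ‖β_1‖² + σ_2² ‖β_2‖²) and let γ ∈ (0,1). If γ ≥ Φ(2‖μ_1‖ / min(σ_1, σ_2)) and β_1ᵀ μ_1 + β_2ᵀ μ_2 ≥ ψ · Φ^{-1}(γ), then β_1ᵀ μ_1 − β_2ᵀ μ_2 ≤ 0. -/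
open MeasureTheory
open scoped RealInnerProductSpace

/-- `Φ`, the cumulative distribution function of the standard normal distribution `N(0,1)`. -/
noncomputable def stdGaussianCDF (x : ℝ) : ℝ :=
  ((ProbabilityTheory.gaussianReal 0 1) (Set.Iic x)).toReal

/-- `Φ⁻¹`, the inverse of the standard normal CDF on `(0,1)`. -/
noncomputable def stdGaussianCDFInv (y : ℝ) : ℝ :=
  Function.invFun stdGaussianCDF y

open ProbabilityTheory in
theorem ProbabilityTheory.continuous_cdf (μ : Measure ℝ) [IsProbabilityMeasure μ] [NullSingletonClass μ] :
    Continuous (cdf μ) := by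
  refine continuous_iff_continuousAt.2 fun x => ?_
  rw [(monotone_cdf μ).continuousAt_iff_leftLim_eq_rightLim, StieltjesFunction.rightLim_eq]
  refine le_antisymm ((monotone_cdf μ).leftLim_le le_rfl) ?_
  have h := (cdf μ).measure_singleton x
  rw [measure_cdf, measure_singleton] at h
  exact sub_nonpos.1 (ENNReal.ofReal_eq_zero.1 h.symm)

open ProbabilityTheory in
theorem stdGaussianCDF_eq_cdf : stdGaussianCDF = cdf (gaussianReal 0 1) :=
  funext fun x => (cdf_eq_real _ x).symm

open ProbabilityTheory in
theorem strictMono_stdGaussianCDF : StrictMono stdGaussianCDF := by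
  intro a b hab
  rw [stdGaussianCDF_eq_cdf]
  have h : gaussianReal 0 1 (Set.Ioc a b) ≠ 0 := fun h0 => by
    have h1 := gaussianReal_absolutelyContinuous' 0 one_ne_zero h0
    rw [Real.volume_Ioc, ENNReal.ofReal_eq_zero] at h1
    linarith
  rw [← measure_cdf (gaussianReal 0 1), StieltjesFunction.measure_Ioc, Ne,
    ENNReal.ofReal_eq_zero, not_le] at h
  exact sub_pos.1 h

open ProbabilityTheory in
theorem stdGaussianCDF_stdGaussianCDFInv {y : ℝ} (hy : y ∈ Set.Ioo (0 : ℝ) 1) :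
    stdGaussianCDF (stdGaussianCDFInv y) = y := by
  have : NullSingletonClass (gaussianReal 0 1) := nullSingletonClass_gaussianReal one_ne_zero
  refine Function.invFun_eq (f := stdGaussianCDF) ?_
  rw [stdGaussianCDF_eq_cdf]
  obtain ⟨a, ha⟩ := ((tendsto_cdf_atBot (gaussianReal 0 1)).eventually_le_const hy.1).exists
  obtain ⟨b, hb⟩ := ((tendsto_cdf_atTop (gaussianReal 0 1)).eventually_const_le hy.2).exists
  exact mem_range_of_exists_le_of_exists_ge (continuous_cdf _) ⟨a, ha⟩ ⟨b, hb⟩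

/-- Algebraic core of the ERM lower bound: if the unit-norm classifier `β = (β_1, β_2)` has
training accuracy at least `γ ≥ Φ(2‖μ_1‖ / min(σ_1, σ_2))`, i.e. its margin satisfies
`β_1ᵀμ_1 + β_2ᵀμ_2 ≥ ψ·Φ⁻¹(γ)` where `ψ = √(σ_1²‖β_1‖² + σ_2²‖β_2‖²)`, then its margin
on the test environment with flipped spurious mean is nonpositive: `β_1ᵀμ_1 − β_2ᵀμ_2 ≤ 0`. -/
theorem erm_margin_flip {r ds : ℕ} (hr : 1 ≤ r) (hds : 1 ≤ ds)
    (σ1 σ2 : ℝ) (hσ1 : 0 < σ1) (hσ2 : 0 < σ2)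
    (μ1 : EuclideanSpace ℝ (Fin r)) (μ2 : EuclideanSpace ℝ (Fin ds))
    (β1 : EuclideanSpace ℝ (Fin r)) (β2 : EuclideanSpace ℝ (Fin ds))
    (hβ : ‖β1‖ ^ 2 + ‖β2‖ ^ 2 = 1)
    (ψ : ℝ) (hψ : ψ = Real.sqrt (σ1 ^ 2 * ‖β1‖ ^ 2 + σ2 ^ 2 * ‖β2‖ ^ 2))
    (γ : ℝ) (hγ : γ ∈ Set.Ioo (0 : ℝ) 1)
    (hγacc : stdGaussianCDF (2 * ‖μ1‖ / min σ1 σ2) ≤ γ)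
    (hmargin : ψ * stdGaussianCDFInv γ ≤ ⟪β1, μ1⟫ + ⟪β2, μ2⟫) :
    ⟪β1, μ1⟫ - ⟪β2, μ2⟫ ≤ 0 := by
  have hm : 0 < min σ1 σ2 := lt_min hσ1 hσ2
  have hle : 2 * ‖μ1‖ / min σ1 σ2 ≤ stdGaussianCDFInv γ := by
    rwa [← strictMono_stdGaussianCDF.le_iff_le, stdGaussianCDF_stdGaussianCDFInv hγ]
  have hψm : min σ1 σ2 ≤ ψ := by
    rw [hψ]
    refine Real.le_sqrt_of_sq_le ?_
    calc min σ1 σ2 ^ 2 = min σ1 σ2 ^ 2 * ‖β1‖ ^ 2 + min σ1 σ2 ^ 2 * ‖β2‖ ^ 2 := by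
          rw [← mul_add, hβ, mul_one]
      _ ≤ σ1 ^ 2 * ‖β1‖ ^ 2 + σ2 ^ 2 * ‖β2‖ ^ 2 := by
          gcongr
          · exact min_le_left _ _
          · exact min_le_right _ _
  have hlower : 2 * ‖μ1‖ ≤ ψ * stdGaussianCDFInv γ :=
    calc 2 * ‖μ1‖ = min σ1 σ2 * (2 * ‖μ1‖ / min σ1 σ2) := by field_simp
      _ ≤ ψ * stdGaussianCDFInv γ := mul_le_mul hψm hle (by positivity) (hm.le.trans hψm)
  have hβ1 : ‖β1‖ ≤ 1 := by nlinarith [sq_nonneg ‖β2‖, norm_nonneg β1]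
  have hinner : ⟪β1, μ1⟫ ≤ ‖μ1‖ :=
    (real_inner_le_norm β1 μ1).trans (mul_le_of_le_one_left (norm_nonneg μ1) hβ1)
  linarith
end

section
/- There exist constants c_1, c_2, b_1, b_2 > 0 such that the following holds for every d_s, every integer 2 ≤ k ≤ d_s/2, every D > 0, and every even integer E with b_1 · ((d_s − k)/(k − 1)) · max{1, log(D/((k−1)·d_s)), log(d_s/(k−1))} < E < b_2 · d_s. Let Σ̄^1, …, Σ̄^E ∈ ℝ^{d_s×d_s} be fixed matrices with max_e ‖Σ̄^e‖_2² ≤ D, let G_1, …, G_E be independent random d_s×d_s matrices with i.i.d. N(0,1) entries, and set Σ_2^e = Σ̄^e + G_e G_eᵀ and, for each odd e < E, Δ^e = Σ_2^e − Σ_2^{e+1}. Then with probability at least 1 − c_1·exp(−d_s), simultaneously for every Q ∈ ℝ^{k×d_s} with Q Qᵀ = I_k (with rows q_1, …, q_k): Σ_{odd e<E} Σ_{i≠j} (q_iᵀ Δ^e q_j)² > c_2 · (A(Q) + E·k·(k−1)·d_s), where A(Q) = Σ_{odd e<E} Σ_{i≠j} (q_iᵀ (Σ̄^e − Σ̄^{e+1})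 q_j)². -/
open Matrix MeasureTheory

/-- The spectral norm (ℓ2 operator norm) of a real square matrix. -/
noncomputable def specNorm {n : ℕ} (M : Matrix (Fin n) (Fin n) ℝ) : ℝ :=
  sSup {c | ∃ v : Fin n → ℝ, (∑ i, v i ^ 2) = 1 ∧
    c = Real.sqrt (∑ i, (M *ᵥ v) i ^ 2)}

/-- The product of `E` independent standard Gaussian measures on `d_s × d_s` matrices
(one i.i.d. `N(0,1)` variable per entry). -/
noncomputable def gaussMatrices (E ds : ℕ) : Measure (Fin E → Fin ds → Fin ds → ℝ) :=
  Measure.pi fun _ => Measure.pi fun _ => Measure.pi fun _ =>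
    ProbabilityTheory.gaussianReal 0 1

/-- `Σ̄^n`, extended by `0` outside `n < E`. -/
noncomputable def barExt {E ds : ℕ} (Sbar : Fin E → Matrix (Fin ds) (Fin ds) ℝ)
    (n : ℕ) : Matrix (Fin ds) (Fin ds) ℝ :=
  if h : n < E then Sbar ⟨n, h⟩ else 0

/-- The smoothed covariance `Σ_2^n = Σ̄^n + G_n G_nᵀ`, extended by `0` outside `n < E`. -/
noncomputable def smoothedCov {E ds : ℕ} (Sbar : Fin E → Matrix (Fin ds) (Fin ds) ℝ)
    (g : Fin E → Fin ds → Fin ds → ℝ) (n : ℕ) : Matrix (Fin ds) (Fin ds) ℝ :=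
  if h : n < E then Sbar ⟨n, h⟩ + Matrix.of (g ⟨n, h⟩) * (Matrix.of (g ⟨n, h⟩))ᵀ else 0

section Auxiliary

open ProbabilityTheory

/-- The standard Gaussian measure on `ι → ℝ`. -/
noncomputable abbrev gaussPi (ι : Type*) [Fintype ι] : Measure (ι → ℝ) :=
  Measure.pi fun _ => gaussianReal 0 1

lemma gaussPi_map_mulVec {ι κ : Type*} [Fintype ι] [Fintype κ] [DecidableEq κ]
    (B : Matrix κ ι ℝ) (hB : B * Bᵀ = 1) :
    (gaussPi ι).map (fun x => B *ᵥ x) = gaussPi κ := by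
  have hm : Measurable (fun x : ι → ℝ => B *ᵥ x) := by
    refine measurable_pi_lambda _ fun i => ?_
    simp only [Matrix.mulVec, dotProduct]
    fun_prop
  have : IsProbabilityMeasure ((gaussPi ι).map (fun x => B *ᵥ x)) :=
    Measure.isProbabilityMeasure_map hm.aemeasurable
  rw [gaussPi, ← charFun_eq_pi_iff]
  intro t
  have h1 : charFun ((gaussPi ι).map (WithLp.toLp 2)) (WithLp.toLp 2 (Bᵀ *ᵥ (t : κ → ℝ)))
      = Complex.exp (- ‖(WithLp.toLp 2 (Bᵀ *ᵥ (t : κ → ℝ)) : EuclideanSpace ℝ ι)‖ ^ 2 / 2) := by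
    rw [map_pi_eq_stdGaussian, charFun_stdGaussian]
  have h2 : charFun (((gaussPi ι).map (fun x => B *ᵥ x)).map (WithLp.toLp 2)) t =
      charFun ((gaussPi ι).map (WithLp.toLp 2)) (WithLp.toLp 2 (Bᵀ *ᵥ (t : κ → ℝ))) := by
    rw [Measure.map_map (by fun_prop) hm, charFun_apply, charFun_apply,
      integral_map (by exact (Measurable.comp (by fun_prop) hm).aemeasurable)
        (Measurable.aestronglyMeasurable (by fun_prop)),
      integral_map (by fun_prop) (Measurable.aestronglyMeasurable (by fun_prop))]
    congr 1
    ext x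
    congr 3
    simp only [Function.comp, EuclideanSpace.inner_eq_star_dotProduct, star_trivial]
    rw [Matrix.dotProduct_mulVec, dotProduct_comm, dotProduct_comm _ x,
      Matrix.dotProduct_mulVec, Matrix.vecMul_transpose, dotProduct_comm,
      ← Matrix.dotProduct_mulVec, dotProduct_comm]
  have h3 : ‖(WithLp.toLp 2 (Bᵀ *ᵥ (t : κ → ℝ)) : EuclideanSpace ℝ ι)‖ ^ 2 = ∑ i, t i ^ 2 := by
    have : (Bᵀ *ᵥ (t : κ → ℝ)) ⬝ᵥ (Bᵀ *ᵥ (t : κ → ℝ)) = (t : κ → ℝ) ⬝ᵥ (t : κ → ℝ) := by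
      rw [Matrix.dotProduct_mulVec, Matrix.vecMul_transpose, Matrix.mulVec_mulVec, hB,
        Matrix.one_mulVec]
    rw [EuclideanSpace.real_norm_sq_eq]
    simpa [dotProduct, pow_two] using this
  rw [h2, h1]
  simp_rw [charFun_gaussianReal, ← Complex.exp_sum, ← Complex.ofReal_pow, h3]
  simp [Finset.sum_div, neg_div]

lemma integral_gaussianReal_exp_quadratic (b c : ℝ) (hc : 0 ≤ c) :
    ∫ z, Real.exp (-(b * z + c * z ^ 2)) ∂(gaussianReal 0 1) =
      (Real.sqrt (1 + 2 * c))⁻¹ * Real.exp (b ^ 2 / (2 * (1 + 2 * c))) := by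
  have hpos : (0 : ℝ) < 1 + 2 * c := by positivity
  rw [integral_gaussianReal_eq_integral_smul (by norm_num)]
  have h : ∀ z : ℝ, gaussianPDFReal 0 1 z • Real.exp (-(b * z + c * z ^ 2)) =
      ((Real.sqrt (2 * Real.pi))⁻¹ * Real.exp (b ^ 2 / (2 * (1 + 2 * c)))) *
        Real.exp (-(1 / 2 + c) * (z + b / (1 + 2 * c)) ^ 2) := by
    intro z
    rw [gaussianPDFReal, smul_eq_mul, mul_assoc, mul_assoc (_)⁻¹, ← Real.exp_add, ← Real.exp_add]
    simp only [NNReal.coe_one, mul_one]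
    congr 2
    field_simp
    ring
  simp_rw [h]
  rw [integral_const_mul, integral_add_right_eq_self
    (fun z => Real.exp (-(1 / 2 + c) * z ^ 2)) (b / (1 + 2 * c)), integral_gaussian]
  have : Real.pi / (1 / 2 + c) = (2 * Real.pi) / (1 + 2 * c) := by field_simp
  rw [this, Real.sqrt_div (by positivity)]
  have : Real.sqrt (2 * Real.pi) ≠ 0 := by positivity
  field_simp

lemma inv_sqrt_one_add_le {c : ℝ} (hc : 0 ≤ c) :
    (Real.sqrt (1 + 2 * c))⁻¹ ≤ Real.exp (-(c / (1 + 2 * c))) := by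
  have hpos : (0 : ℝ) < 1 + 2 * c := by positivity
  rw [Real.exp_neg]
  apply inv_anti₀ (Real.exp_pos _)
  apply Real.le_sqrt_of_sq_le
  rw [← Real.exp_nat_mul]
  have h := Real.one_sub_inv_le_log_of_pos hpos
  rw [← Real.le_log_iff_exp_le hpos]
  refine le_trans (le_of_eq ?_) h
  push_cast
  field_simp
  ring

lemma integral_gaussianReal_exp_quadratic_le (b c : ℝ) (hc : 0 ≤ c) :
    ∫ z, Real.exp (-(b * z + c * z ^ 2)) ∂(gaussianReal 0 1) ≤
      Real.exp (b ^ 2 / (2 * (1 + 2 * c)) - c / (1 + 2 * c)) := by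
  rw [integral_gaussianReal_exp_quadratic b c hc, sub_eq_neg_add, Real.exp_add]
  gcongr
  exact inv_sqrt_one_add_le hc

lemma sum_sq_inner_div_le {F ι : Type*} [Fintype ι] [NormedAddCommGroup F] [InnerProductSpace ℝ F]
    (a : F) (f : ι → F) (hf : Pairwise fun i j => inner ℝ (f i) (f j) = 0) :
    ∑ i, (inner ℝ a (f i)) ^ 2 / ‖f i‖ ^ 2 ≤ ‖a‖ ^ 2 := by
  classical
  set w : ι → ℝ := fun i => inner ℝ a (f i) / ‖f i‖ ^ 2
  have h0 : 0 ≤ ‖a - ∑ i, w i • f i‖ ^ 2 := by positivity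
  have h1 : ‖∑ i, w i • f i‖ ^ 2 = ∑ i, (inner ℝ a (f i)) ^ 2 / ‖f i‖ ^ 2 := by
    rw [← real_inner_self_eq_norm_sq, sum_inner]
    refine Finset.sum_congr rfl fun i _ => ?_
    rw [inner_sum, Finset.sum_eq_single i]
    · rw [real_inner_smul_left, real_inner_smul_right, real_inner_self_eq_norm_sq]
      by_cases h : ‖f i‖ ^ 2 = 0
      · simp [w, h]
      · simp only [w]; field_simp
    · intro j _ hj
      rw [real_inner_smul_left, real_inner_smul_right, hf hj.symm]; simp
    · simp
  have h2 : inner ℝ a (∑ i, w i • f i) = ∑ i, (inner ℝ a (f i)) ^ 2 / ‖f i‖ ^ 2 := by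
    rw [inner_sum]
    refine Finset.sum_congr rfl fun i _ => ?_
    rw [real_inner_smul_right]; simp only [w]; ring
  rw [norm_sub_sq_real, h1, h2] at h0
  linarith

lemma sum_norm_sq_apply_eq_trace {V F κ : Type*} [Fintype κ]
    [NormedAddCommGroup V] [InnerProductSpace ℝ V] [FiniteDimensional ℝ V]
    [NormedAddCommGroup F] [InnerProductSpace ℝ F] [FiniteDimensional ℝ F] (T : V →ₗ[ℝ] F)
    (u : OrthonormalBasis κ ℝ V) :
    ∑ i, ‖T (u i)‖ ^ 2 = LinearMap.trace ℝ V (LinearMap.adjoint T ∘ₗ T) := by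
  rw [LinearMap.trace_eq_sum_inner _ u]
  refine Finset.sum_congr rfl fun i _ => ?_
  simp [LinearMap.adjoint_inner_right]

lemma lintegral_stdGaussian_exp_neg_norm_sq_le {V F : Type*}
    [NormedAddCommGroup V] [InnerProductSpace ℝ V] [FiniteDimensional ℝ V]
    [MeasurableSpace V] [BorelSpace V]
    [NormedAddCommGroup F] [InnerProductSpace ℝ F] [FiniteDimensional ℝ F] (T : V →ₗ[ℝ] F)
    {ι : Type*} [Fintype ι] (e : OrthonormalBasis ι ℝ V)
    (a : F) {Γ l : ℝ} (hl : 0 < l) (hT : ∀ v, ‖T v‖ ^ 2 ≤ Γ * ‖v‖ ^ 2) (hΓ : 0 ≤ Γ) :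
    ∫⁻ v, ENNReal.ofReal (Real.exp (-(l * ‖a + T v‖ ^ 2))) ∂(stdGaussian V) ≤
      ENNReal.ofReal (Real.exp (-(l / (1 + 2 * l * Γ) * (‖a‖ ^ 2 + ∑ i, ‖T (e i)‖ ^ 2)))) := by
  classical
  have hS : (LinearMap.adjoint T ∘ₗ T).IsSymmetric := by
    intro x y
    simp [LinearMap.adjoint_inner_left, LinearMap.adjoint_inner_right]
  set b := hS.eigenvectorBasis rfl
  have horth : Pairwise fun i j => inner ℝ (T (b i)) (T (b j)) = 0 := by
    intro i j hij
    have : inner ℝ (T (b i)) (T (b j)) = inner ℝ (b i) ((LinearMap.adjoint T ∘ₗ T) (b j)) := by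
      simp [LinearMap.adjoint_inner_right]
    rw [this, hS.apply_eigenvectorBasis]
    simp only [inner_smul_right]
    rw [b.orthonormal.2 hij, mul_zero]
  set g : Fin (Module.finrank ℝ V) → ℝ := fun i => ‖T (b i)‖ ^ 2
  have hg0 : ∀ i, 0 ≤ g i := fun i => by positivity
  have hgΓ : ∀ i, g i ≤ Γ := fun i => by
    have := hT (b i); simpa [b.orthonormal.1 i] using this
  set β : Fin (Module.finrank ℝ V) → ℝ := fun i => inner ℝ a (T (b i))
  have htr : ∑ i, ‖T (e i)‖ ^ 2 = ∑ i, g i := by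
    rw [sum_norm_sq_apply_eq_trace T e, sum_norm_sq_apply_eq_trace T b]
  have hexp : ∀ x : Fin (Module.finrank ℝ V) → ℝ,
      Real.exp (-(l * ‖a + T (∑ i, x i • b i)‖ ^ 2)) =
        Real.exp (-(l * ‖a‖ ^ 2)) *
          ∏ i, Real.exp (-((2 * l * β i) * x i + (l * g i) * x i ^ 2)) := by
    intro x
    rw [← Real.exp_sum, ← Real.exp_add]
    congr 1
    have h1 : ‖T (∑ i, x i • b i)‖ ^ 2 = ∑ i, x i ^ 2 * g i := by
      rw [map_sum, ← real_inner_self_eq_norm_sq, sum_inner]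
      refine Finset.sum_congr rfl fun i _ => ?_
      rw [inner_sum, Finset.sum_eq_single i]
      · rw [map_smul, real_inner_smul_left, real_inner_smul_right, real_inner_self_eq_norm_sq]
        simp only [g]; ring
      · intro j _ hj
        rw [map_smul, map_smul, real_inner_smul_left, real_inner_smul_right, horth hj.symm]; simp
      · simp
    have h2 : inner ℝ a (T (∑ i, x i • b i)) = ∑ i, x i * β i := by
      rw [map_sum, inner_sum]
      refine Finset.sum_congr rfl fun i _ => ?_
      rw [map_smul, real_inner_smul_right]
    rw [norm_add_sq_real, h1, h2]
    simp only [Finset.sum_neg_distrib, Finset.sum_add_distrib, mul_add, Finset.mul_sum, neg_add]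
    rw [add_assoc]
    congr 3
    · refine Finset.sum_congr rfl fun i _ => ?_
      ring
    · refine Finset.sum_congr rfl fun i _ => ?_
      ring
  have hcont : Continuous T := T.continuous_of_finiteDimensional
  have hcont2 : Continuous fun v => Real.exp (-(l * ‖a + T v‖ ^ 2)) := by fun_prop
  have hcont3 : Continuous fun x : Fin (Module.finrank ℝ V) → ℝ =>
      Real.exp (-(l * ‖a + T (∑ i, x i • b i)‖ ^ 2)) :=
    hcont2.comp (by fun_prop)
  rw [stdGaussian_eq_map_pi_orthonormalBasis b, lintegral_map
    hcont2.measurable.ennreal_ofReal (by fun_prop)]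
  rw [← ofReal_integral_eq_lintegral_ofReal]
  · apply ENNReal.ofReal_le_ofReal
    simp_rw [hexp]
    rw [integral_const_mul, integral_fintype_prod_eq_prod
      (f := fun i z => Real.exp (-((2 * l * β i) * z + (l * g i) * z ^ 2)))]
    calc _ ≤ Real.exp (-(l * ‖a‖ ^ 2)) *
            ∏ i, Real.exp ((2 * l * β i) ^ 2 / (2 * (1 + 2 * (l * g i)))
              - (l * g i) / (1 + 2 * (l * g i))) := by
          gcongr with i
          exact integral_gaussianReal_exp_quadratic_le _ _ (mul_nonneg hl.le (hg0 i))
      _ ≤ _ := by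
          rw [← Real.exp_sum, ← Real.exp_add]
          apply Real.exp_le_exp.2
          have hb := sum_sq_inner_div_le a (fun i => T (b i)) horth
          have hterm : ∀ i, (2 * l * β i) ^ 2 / (2 * (1 + 2 * (l * g i)))
              - (l * g i) / (1 + 2 * (l * g i)) ≤
              (l - l / (1 + 2 * l * Γ)) * (β i ^ 2 / g i) - l / (1 + 2 * l * Γ) * g i := by
            intro i
            have hgi := hg0 i
            have hgΓi := hgΓ i
            have h1 : l / (1 + 2 * l * Γ) ≤ l / (1 + 2 * (l * g i)) := by
              apply div_le_div_of_nonneg_left hl.le (by positivity)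
              nlinarith
            have h3 : (l * g i) / (1 + 2 * (l * g i)) ≥ l / (1 + 2 * l * Γ) * g i := by
              rw [mul_div_right_comm]
              gcongr
            have h2 : (2 * l * β i) ^ 2 / (2 * (1 + 2 * (l * g i))) ≤
                (l - l / (1 + 2 * (l * g i))) * (β i ^ 2 / g i) := by
              rcases hgi.eq_or_lt with h | h
              · have : T (b i) = 0 := by simpa [g] using h.symm
                simp [β, this]
              · apply le_of_eq
                field_simp
                ring
            have h4 : (l - l / (1 + 2 * (l * g i))) * (β i ^ 2 / g i) ≤
                (l - l / (1 + 2 * l * Γ)) * (β i ^ 2 / g i) := by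
              gcongr
            linarith
          have hk : 0 ≤ l - l / (1 + 2 * l * Γ) := by
            rw [sub_nonneg]
            apply div_le_self hl.le
            nlinarith [mul_nonneg hl.le hΓ]
          calc _ ≤ -(l * ‖a‖ ^ 2) + ∑ i, ((l - l / (1 + 2 * l * Γ)) * (β i ^ 2 / g i)
                    - l / (1 + 2 * l * Γ) * g i) := by
                exact add_le_add_right (Finset.sum_le_sum fun i _ => hterm i) _
            _ ≤ _ := by
                rw [Finset.sum_sub_distrib, ← Finset.mul_sum, ← Finset.mul_sum, htr]
                have := mul_le_mul_of_nonneg_left hb hk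
                simp only [β, g] at *
                linarith
  · refine Integrable.of_bound (C := 1) hcont3.aestronglyMeasurable
      (Filter.Eventually.of_forall fun x => ?_)
    rw [Real.norm_eq_abs, abs_of_pos (Real.exp_pos _), Real.exp_le_one_iff]
    have : 0 ≤ l * ‖a + T (∑ i, x i • b i)‖ ^ 2 := by positivity
    linarith
  · exact Filter.Eventually.of_forall fun x => (Real.exp_pos _).le

lemma lintegral_gaussPi_exp_neg_sum_sq_le {ι κ : Type*} [Fintype ι] [Fintype κ]
    (M : Matrix κ ι ℝ) (a : κ → ℝ) {Γ l : ℝ} (hl : 0 < l) (hΓ : 0 ≤ Γ)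
    (hM : ∀ u : ι → ℝ, ∑ r, (M *ᵥ u) r ^ 2 ≤ Γ * ∑ i, u i ^ 2) :
    ∫⁻ u, ENNReal.ofReal (Real.exp (-(l * ∑ r, (a r + (M *ᵥ u) r) ^ 2))) ∂(gaussPi ι) ≤
      ENNReal.ofReal (Real.exp
        (-(l / (1 + 2 * l * Γ) * (∑ r, a r ^ 2 + ∑ r, ∑ i, M r i ^ 2)))) := by
  classical
  let T : EuclideanSpace ℝ ι →ₗ[ℝ] EuclideanSpace ℝ κ := Matrix.toEuclideanLin M
  have hT : ∀ v, T v = WithLp.toLp 2 (M *ᵥ v.ofLp) := fun v => rfl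
  have h := lintegral_stdGaussian_exp_neg_norm_sq_le T (EuclideanSpace.basisFun ι ℝ)
    (WithLp.toLp 2 a) hl (Γ := Γ)
    (by intro v; simpa [EuclideanSpace.real_norm_sq_eq, hT] using hM v.ofLp) hΓ
  have hTc : Continuous T := T.continuous_of_finiteDimensional
  have hcont : Continuous fun v => Real.exp (-(l * ‖WithLp.toLp 2 a + T v‖ ^ 2)) := by fun_prop
  rw [← map_pi_eq_stdGaussian, lintegral_map hcont.measurable.ennreal_ofReal (by fun_prop)] at h
  have h2 : ∑ r, ∑ i, M r i ^ 2 = ∑ i, ‖T (EuclideanSpace.basisFun ι ℝ i)‖ ^ 2 := by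
    rw [Finset.sum_comm]
    refine Finset.sum_congr rfl fun i _ => ?_
    simp [EuclideanSpace.real_norm_sq_eq, hT, Matrix.mulVec_single]
  rw [h2]
  simpa [EuclideanSpace.real_norm_sq_eq, hT] using h

lemma lintegral_gaussPi_exp_neg_sum_mul_sq_le {ι : Type*} [Fintype ι] (s : ι → ℝ)
    (hs : ∀ i, 0 ≤ s i) (hs1 : ∀ i, s i ≤ 1) :
    ∫⁻ u, ENNReal.ofReal (Real.exp (-∑ i, s i * u i ^ 2)) ∂(gaussPi ι) ≤
      ENNReal.ofReal (Real.exp (-((1 / 3) * ∑ i, s i))) := by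
  have hcont : Continuous fun u : ι → ℝ => Real.exp (-∑ i, s i * u i ^ 2) := by fun_prop
  rw [← ofReal_integral_eq_lintegral_ofReal]
  · apply ENNReal.ofReal_le_ofReal
    have h : ∀ u : ι → ℝ, Real.exp (-∑ i, s i * u i ^ 2) =
        ∏ i, Real.exp (-(0 * u i + s i * u i ^ 2)) := by
      intro u
      rw [← Real.exp_sum]; simp
    simp_rw [h]
    rw [integral_fintype_prod_eq_prod (f := fun i z => Real.exp (-(0 * z + s i * z ^ 2))),
      Finset.mul_sum, ← Finset.sum_neg_distrib, Real.exp_sum]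
    gcongr with i _
    refine (integral_gaussianReal_exp_quadratic_le 0 (s i) (hs i)).trans ?_
    apply Real.exp_le_exp.2
    have h0 := hs i
    have h1 := hs1 i
    have : 1 / 3 * s i ≤ s i / (1 + 2 * s i) := by
      rw [le_div_iff₀ (by positivity)]
      nlinarith
    simp only [ne_eq, OfNat.ofNat_ne_zero, not_false_eq_true, zero_pow, zero_div]
    linarith
  · refine Integrable.of_bound (C := 1) hcont.aestronglyMeasurable
      (Filter.Eventually.of_forall fun x => ?_)
    rw [Real.norm_eq_abs, abs_of_pos (Real.exp_pos _), Real.exp_le_one_iff]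
    have : 0 ≤ ∑ i, s i * x i ^ 2 := Finset.sum_nonneg fun i _ => mul_nonneg (hs i) (sq_nonneg _)
    linarith
  · exact Filter.Eventually.of_forall fun x => (Real.exp_pos _).le

lemma gaussPi_prod_map_ite {ι : Type*} [Fintype ι] (S : ι → Prop) [DecidablePred S] :
    ((gaussPi ι).prod (gaussPi ι)).map (fun z i => if S i then z.2 i else z.1 i) = gaussPi ι := by
  have hm : Measurable fun (z : (ι → ℝ) × (ι → ℝ)) (i : ι) => if S i then z.2 i else z.1 i := by
    refine measurable_pi_lambda _ fun i => ?_
    split_ifs <;> fun_prop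
  symm
  refine Measure.pi_eq fun s hs => ?_
  rw [Measure.map_apply hm (MeasurableSet.univ_pi hs)]
  have : (fun (z : (ι → ℝ) × (ι → ℝ)) (i : ι) => if S i then z.2 i else z.1 i) ⁻¹' Set.univ.pi s =
      (Set.univ.pi fun i => if S i then Set.univ else s i) ×ˢ
        (Set.univ.pi fun i => if S i then s i else Set.univ) := by
    ext z
    simp only [Set.mem_preimage, Set.mem_pi, Set.mem_univ, true_imp_iff, Set.mem_prod]
    constructor
    · intro h
      exact ⟨fun i => by have := h i; split_ifs at * <;> simp_all,
        fun i => by have := h i; split_ifs at * <;> simp_all⟩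
    · rintro ⟨h1, h2⟩ i
      have h1 := h1 i
      have h2 := h2 i
      split_ifs at * <;> simp_all
  rw [this, Measure.prod_prod, Measure.pi_pi, Measure.pi_pi, ← Finset.prod_mul_distrib]
  refine Finset.prod_congr rfl fun i _ => ?_
  split_ifs <;> simp

section Block

variable {P K L : Type*} [Fintype P] [Fintype K] [Fintype L] [DecidableEq K]

/-- The sign attached to the two members of a pair. -/
def pairSign (b : Bool) : ℝ := if b then -1 else 1

/-- Entries of `a + ∑ b, ± X_b X_bᵀ` where `X_b` is the `b`-th member of the `p`-th pair. -/
noncomputable def gramEntry (a : P → K → K → ℝ) (x : P × Bool × K × L → ℝ) (p : P) (i j : K) : ℝ :=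
  a p i j + ∑ b, pairSign b * ∑ l, x (p, b, i, l) * x (p, b, j, l)

/-- The matrix of the linear map sending the rows indexed by `I` to the `I × Iᶜ` blocks of the
signed Gram matrices, when the rows outside `I` are given by `w`. -/
noncomputable def crossMatrix [DecidableEq P] (I : Finset K) (w : P × Bool × K × L → ℝ) :
    Matrix (P × K × K) (P × Bool × K × L) ℝ :=
  fun r c => if r.1 = c.1 ∧ r.2.1 = c.2.2.1 ∧ r.2.1 ∈ I ∧ r.2.2 ∉ I then
    pairSign c.2.1 * w (r.1, c.2.1, r.2.2, c.2.2.2) else 0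

lemma crossMatrix_mulVec [DecidableEq P] (I : Finset K) (w u : P × Bool × K × L → ℝ)
    (p : P) (i j : K) :
    (crossMatrix I w *ᵥ u) (p, i, j) = if i ∈ I ∧ j ∉ I then
      ∑ b, pairSign b * ∑ l, u (p, b, i, l) * w (p, b, j, l) else 0 := by
  simp only [Matrix.mulVec, dotProduct, crossMatrix, Fintype.sum_prod_type]
  rw [Finset.sum_eq_single p (by intro q _ hq; simp [hq.symm]) (by simp)]
  split_ifs with h
  · refine Finset.sum_congr rfl fun b _ => ?_
    rw [Finset.sum_eq_single i (by intro q _ hq; simp [hq.symm]) (by simp), Finset.mul_sum]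
    refine Finset.sum_congr rfl fun l _ => ?_
    simp [h]; ring
  · refine Finset.sum_eq_zero fun b _ => Finset.sum_eq_zero fun q _ =>
      Finset.sum_eq_zero fun l _ => ?_
    rw [if_neg (by tauto), zero_mul]

lemma sum_crossMatrix_sq [DecidableEq P] (I : Finset K) (w : P × Bool × K × L → ℝ) :
    ∑ r, ∑ c, crossMatrix I w r c ^ 2 =
      ∑ c : P × Bool × K × L, (if c.2.2.1 ∈ I then 0 else (I.card : ℝ)) * w c ^ 2 := by
  have hs : ∀ b, pairSign b ^ 2 = 1 := by intro b; cases b <;> simp [pairSign]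
  have h1 : ∀ p i j, ∑ c, crossMatrix I w (p, i, j) c ^ 2 =
      if i ∈ I ∧ j ∉ I then ∑ b, ∑ l, w (p, b, j, l) ^ 2 else 0 := by
    intro p i j
    simp only [crossMatrix, Fintype.sum_prod_type]
    rw [Finset.sum_eq_single p (by intro q _ hq; simp [hq.symm]) (by simp)]
    split_ifs with h
    · refine Finset.sum_congr rfl fun b _ => ?_
      rw [Finset.sum_eq_single i (by intro q _ hq; simp [hq.symm]) (by simp)]
      refine Finset.sum_congr rfl fun l _ => ?_
      simp [h, mul_pow, hs]
    · refine Finset.sum_eq_zero fun b _ => Finset.sum_eq_zero fun q _ =>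
        Finset.sum_eq_zero fun l _ => ?_
      rw [if_neg (by tauto)]; simp
  have h2 : ∑ r, ∑ c, crossMatrix I w r c ^ 2 =
      ∑ p, ∑ i, ∑ j, if i ∈ I ∧ j ∉ I then ∑ b, ∑ l, w (p, b, j, l) ^ 2 else 0 := by
    rw [Fintype.sum_prod_type]
    refine Finset.sum_congr rfl fun p _ => ?_
    rw [Fintype.sum_prod_type]
    simp only [h1]
  rw [h2]
  simp only [Fintype.sum_prod_type]
  refine Finset.sum_congr rfl fun p _ => ?_
  conv_lhs => rw [Finset.sum_comm]
  conv_rhs => rw [Finset.sum_comm]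
  refine Finset.sum_congr rfl fun j _ => ?_
  by_cases hj : j ∈ I
  · simp [hj]
  · simp [hj, ← Finset.mul_sum]
    ring

lemma sum_crossMatrix_mulVec_sq_le [DecidableEq P] (I : Finset K) (w u : P × Bool × K × L → ℝ)
    {Γ : ℝ}
    (hw : ∀ p b (v : L → ℝ), ∑ j, (if j ∈ I then 0 else (∑ l, v l * w (p, b, j, l)) ^ 2) ≤
      Γ * ∑ l, v l ^ 2) :
    ∑ r, (crossMatrix I w *ᵥ u) r ^ 2 ≤ 2 * Γ * ∑ c, u c ^ 2 := by
  have hs : ∀ b, pairSign b ^ 2 = 1 := by intro b; cases b <;> simp [pairSign]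
  simp only [Fintype.sum_prod_type, crossMatrix_mulVec, Finset.mul_sum (s := Finset.univ (α := P))]
  refine Finset.sum_le_sum fun p _ => ?_
  calc _ ≤ ∑ i, ∑ b, 2 * Γ * ∑ l, u (p, b, i, l) ^ 2 := by
        refine Finset.sum_le_sum fun i _ => ?_
        calc _ ≤ ∑ j, ∑ b, 2 * (if j ∈ I then 0 else
                (∑ l, u (p, b, i, l) * w (p, b, j, l)) ^ 2) := by
              refine Finset.sum_le_sum fun j _ => ?_
              by_cases hj : j ∈ I
              · simp [hj]
              · by_cases hi : i ∈ I
                · simp only [hi, hj, not_false_eq_true, and_self, if_true, if_false,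
                    Fintype.sum_bool, pairSign]
                  simp only [Bool.false_eq_true, if_false]
                  generalize ∑ l, u (p, true, i, l) * w (p, true, j, l) = s
                  generalize ∑ l, u (p, false, i, l) * w (p, false, j, l) = t
                  nlinarith [sq_nonneg (s + t)]
                · simp [hi, hj]; positivity
          _ = ∑ b, 2 * ∑ j, (if j ∈ I then 0 else
                (∑ l, u (p, b, i, l) * w (p, b, j, l)) ^ 2) := by
              rw [Finset.sum_comm]; simp only [Finset.mul_sum]
          _ ≤ _ := by
              refine Finset.sum_le_sum fun b _ => ?_
              have := hw p b (fun l => u (p, b, i, l))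
              nlinarith
    _ = _ := by
        rw [Finset.sum_comm]
        simp only [Finset.mul_sum]

end Block

section Chernoff

variable {P K L : Type*} [Fintype P] [Fintype K] [Fintype L]

/-- For every environment, the matrix with rows `x (p, b, j, ·)` has squared operator norm
at most `Γ`. -/
def RowsBounded (Γ : ℝ) (x : P × Bool × K × L → ℝ) : Prop :=
  ∀ p b (v : L → ℝ), ∑ j, (∑ l, v l * x (p, b, j, l)) ^ 2 ≤ Γ * ∑ l, v l ^ 2

lemma measurableSet_rowsBounded (Γ : ℝ) :
    MeasurableSet {x : P × Bool × K × L → ℝ | RowsBounded Γ x} := by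
  apply IsClosed.measurableSet
  simp only [RowsBounded, Set.ofPred_forall]
  refine isClosed_iInter fun p => isClosed_iInter fun b => isClosed_iInter fun v =>
    isClosed_le (by fun_prop) (by fun_prop)

variable [DecidableEq K]

lemma lintegral_exp_neg_block_le [Nonempty L] (hKL : Fintype.card K ≤ Fintype.card L)
    (a : P → K → K → ℝ) (I : Finset K) :
    ∫⁻ x, {x : P × Bool × K × L → ℝ | RowsBounded (64 * Fintype.card L) x}.indicator
      (fun x => ENNReal.ofReal (Real.exp (-(1 / Fintype.card L * ∑ p, ∑ i, ∑ j,
        if i ∈ I ∧ j ∉ I then gramEntry a x p i j ^ 2 else 0)))) x ∂(gaussPi _) ≤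
    ENNReal.ofReal (Real.exp (-(1 / (771 * Fintype.card L) * ∑ p : P, ∑ i, ∑ j,
        if i ∈ I ∧ j ∉ I then (a p i j ^ 2 + 2 * Fintype.card L) else 0))) := by
  classical
  set n : ℝ := ((Fintype.card L : ℕ) : ℝ) with hn
  have hn0 : 0 < n := by rw [hn]; exact_mod_cast Fintype.card_pos
  set a' : P × K × K → ℝ := fun r => if r.2.1 ∈ I ∧ r.2.2 ∉ I then a r.1 r.2.1 r.2.2 else 0
  set mix : ((P × Bool × K × L → ℝ) × (P × Bool × K × L → ℝ)) → (P × Bool × K × L → ℝ) :=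
    fun z c => if c.2.2.1 ∈ I then z.2 c else z.1 c with hmix
  have hmixm : Measurable mix := by
    refine measurable_pi_lambda _ fun c => ?_
    simp only [hmix]
    split_ifs <;> fun_prop
  have hcont : Continuous fun x : P × Bool × K × L → ℝ =>
      Real.exp (-(1 / n * ∑ p, ∑ i, ∑ j,
        if i ∈ I ∧ j ∉ I then gramEntry a x p i j ^ 2 else 0)) := by
    have : ∀ p i j, Continuous fun x : P × Bool × K × L → ℝ =>
        (if i ∈ I ∧ j ∉ I then gramEntry a x p i j ^ 2 else 0) := by
      intro p i j
      split_ifs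
      · simp only [gramEntry]; fun_prop
      · exact continuous_const
    fun_prop
  have hmeas := hcont.measurable.ennreal_ofReal.indicator
    (measurableSet_rowsBounded (P := P) (K := K) (L := L) (64 * n))
  have hlaw : ((gaussPi (P × Bool × K × L)).prod (gaussPi _)).map mix = gaussPi _ :=
    gaussPi_prod_map_ite (fun c : P × Bool × K × L => c.2.2.1 ∈ I)
  conv_lhs => rw [← hlaw]
  rw [lintegral_map hmeas hmixm, lintegral_prod _ (by exact (hmeas.comp hmixm).aemeasurable)]
  set s : P × Bool × K × L → ℝ := fun c =>
    1 / (257 * n) * (if c.2.2.1 ∈ I then 0 else (I.card : ℝ)) with hs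
  set A : ℝ := ∑ p, ∑ i, ∑ j, if i ∈ I ∧ j ∉ I then a p i j ^ 2 else 0 with hA
  have hA' : A = ∑ r, a' r ^ 2 := by
    simp only [Fintype.sum_prod_type, hA, a']
    simp
  have hinner : ∀ w : P × Bool × K × L → ℝ,
      ∫⁻ u, {x : P × Bool × K × L → ℝ | RowsBounded (64 * n) x}.indicator
        (fun x => ENNReal.ofReal (Real.exp (-(1 / n * ∑ p, ∑ i, ∑ j,
        if i ∈ I ∧ j ∉ I then gramEntry a x p i j ^ 2 else 0)))) (mix (w, u)) ∂(gaussPi _) ≤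
      ENNReal.ofReal (Real.exp (-(1 / (257 * n) * A))) *
        ENNReal.ofReal (Real.exp (-∑ c, s c * w c ^ 2)) := by
    intro w
    by_cases hw : ∀ p b (v : L → ℝ),
        ∑ j, (if j ∈ I then 0 else (∑ l, v l * w (p, b, j, l)) ^ 2) ≤ 64 * n * ∑ l, v l ^ 2
    · have h1 := lintegral_gaussPi_exp_neg_sum_sq_le (crossMatrix I w) a' (l := 1 / n)
        (Γ := 2 * (64 * n)) (by positivity) (by positivity)
        (fun u => sum_crossMatrix_mulVec_sq_le I w u hw)
      rw [← ENNReal.ofReal_mul (Real.exp_pos _).le, ← Real.exp_add]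
      refine le_trans (le_trans (lintegral_mono fun u => ?_) h1) (le_of_eq ?_)
      · refine (Set.indicator_le_self _ _ _).trans (le_of_eq ?_)
        congr 4
        simp only [Fintype.sum_prod_type]
        refine Finset.sum_congr rfl fun p _ => Finset.sum_congr rfl fun i _ =>
          Finset.sum_congr rfl fun j _ => ?_
        rw [crossMatrix_mulVec]
        by_cases h : i ∈ I ∧ j ∉ I
        · simp only [h, a', gramEntry, hmix]
          simp
        · simp only [h, a', if_false]
          simp
      · rw [sum_crossMatrix_sq, ← hA']
        congr 2
        have : 1 / n / (1 + 2 * (1 / n) * (2 * (64 * n))) = 1 / (257 * n) := by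
          field_simp; norm_num
        rw [this, mul_add, neg_add]
        simp only [hs, mul_assoc, Finset.mul_sum (s := (Finset.univ : Finset (P × Bool × K × L)))]
    · refine le_trans (le_of_eq ?_) zero_le
      rw [lintegral_eq_zero_iff (by exact hmeas.comp (hmixm.comp (by fun_prop)))]
      refine Filter.Eventually.of_forall fun u => ?_
      refine Set.indicator_of_notMem ?_ _
      intro hb
      apply hw
      intro p b v
      refine le_trans (Finset.sum_le_sum fun j _ => ?_) (hb p b v)
      split_ifs with hj
      · positivity
      · simp [hmix, hj]
  refine (lintegral_mono hinner).trans ?_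
  rw [lintegral_const_mul _ (by fun_prop)]
  have hIc : (I.card : ℝ) ≤ n := by
    rw [hn]; exact_mod_cast (Finset.card_le_univ I).trans hKL
  have h3 := lintegral_gaussPi_exp_neg_sum_mul_sq_le s
    (fun c => by simp only [hs]; split_ifs <;> positivity)
    (fun c => by
      simp only [hs]
      split_ifs
      · simp
      · rw [one_div, inv_mul_le_iff₀ (by positivity)]; linarith)
  refine (mul_le_mul_right h3 _).trans ?_
  rw [← ENNReal.ofReal_mul (Real.exp_pos _).le, ← Real.exp_add]
  apply ENNReal.ofReal_le_ofReal
  apply Real.exp_le_exp.2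
  have hA0 : 0 ≤ A := by
    rw [hA']; positivity
  have hsum : ∑ c, s c = 1 / (257 * n) * ∑ p : P, ∑ i, ∑ j,
      (if i ∈ I ∧ j ∉ I then 2 * n else 0) := by
    simp only [hs, ← Finset.mul_sum]
    congr 1
    simp only [Fintype.sum_prod_type]
    refine Finset.sum_congr rfl fun p _ => ?_
    conv_rhs => rw [Finset.sum_comm]
    rw [Finset.sum_comm]
    refine Finset.sum_congr rfl fun j _ => ?_
    by_cases hj : j ∈ I
    · simp [hj]
    · simp [hj, ← hn]; ring
  have hsplit : ∑ p : P, ∑ i, ∑ j, (if i ∈ I ∧ j ∉ I then (a p i j ^ 2 + 2 * n) else 0) =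
      A + ∑ p : P, ∑ i, ∑ j, (if i ∈ I ∧ j ∉ I then 2 * n else 0) := by
    simp only [hA, ← Finset.sum_add_distrib]
    refine Finset.sum_congr rfl fun p _ => Finset.sum_congr rfl fun i _ =>
          Finset.sum_congr rfl fun j _ => ?_
    split_ifs <;> simp
  rw [hsum, hsplit]
  generalize ∑ p : P, ∑ i, ∑ j, (if i ∈ I ∧ j ∉ I then 2 * n else 0) = B
  have : 1 / (771 * n) * A ≤ 1 / (257 * n) * A := by
    gcongr; norm_num
  have h5 : 1 / 3 * (1 / (257 * n) * B) = 1 / (771 * n) * B := by field_simp; ring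
  rw [h5]
  linarith

lemma card_filter_mem_notMem {i j : K} (hij : i ≠ j) :
    4 * ((Finset.univ.filter fun I : Finset K => i ∈ I ∧ j ∉ I).card : ℝ) =
      2 ^ Fintype.card K := by
  have h : (Finset.univ.filter fun I : Finset K => i ∈ I ∧ j ∉ I) =
      ((Finset.univ.erase i).erase j).powerset.image (insert i) := by
    ext I
    simp only [Finset.mem_filter, Finset.mem_univ, true_and, Finset.mem_image,
      Finset.mem_powerset]
    constructor
    · rintro ⟨h1, h2⟩
      refine ⟨I.erase i, ?_, Finset.insert_erase h1⟩
      intro q hq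
      simp only [Finset.mem_erase, Finset.mem_univ, and_true] at hq ⊢
      exact ⟨fun h => h2 (h ▸ hq.2), hq.1⟩
    · rintro ⟨J, hJ, rfl⟩
      refine ⟨Finset.mem_insert_self _ _, ?_⟩
      rw [Finset.mem_insert, not_or]
      exact ⟨hij.symm, fun h => by simpa using hJ h⟩
  rw [h, Finset.card_image_of_injOn, Finset.card_powerset,
    Finset.card_erase_of_mem (by simp [hij.symm]),
    Finset.card_erase_of_mem (by simp), Finset.card_univ]
  · have h2 : 2 ≤ Fintype.card K := by
      have := Finset.card_le_univ ({i, j} : Finset K)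
      rwa [Finset.card_pair hij] at this
    obtain ⟨q, hq⟩ := Nat.exists_eq_add_of_le h2
    rw [hq, show 2 + q - 1 - 1 = q by omega, pow_add]
    push_cast; ring
  · intro J hJ J' hJ' hh
    have hi : i ∉ J := fun h => by simpa using Finset.mem_powerset.1 hJ h
    have hi' : i ∉ J' := fun h => by simpa using Finset.mem_powerset.1 hJ' h
    rw [← Finset.erase_insert hi, ← Finset.erase_insert hi', hh]

lemma sum_finset_cross_eq (f : K → K → ℝ) :
    ∑ I : Finset K, ∑ i, ∑ j, (if i ∈ I ∧ j ∉ I then f i j else 0) =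
      2 ^ Fintype.card K / 4 * ∑ i, ∑ j, (if i = j then 0 else f i j) := by
  rw [Finset.sum_comm, Finset.mul_sum]
  refine Finset.sum_congr rfl fun i _ => ?_
  rw [Finset.sum_comm, Finset.mul_sum]
  refine Finset.sum_congr rfl fun j _ => ?_
  rw [← Finset.sum_filter, Finset.sum_const, nsmul_eq_mul]
  split_ifs with h
  · subst h
    simp
  · rw [← card_filter_mem_notMem h]; ring

lemma lintegral_exp_neg_offDiag_le [Nonempty L] (hKL : Fintype.card K ≤ Fintype.card L)
    (a : P → K → K → ℝ) :
    ∫⁻ x, {x : P × Bool × K × L → ℝ | RowsBounded (64 * Fintype.card L) x}.indicator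
      (fun x => ENNReal.ofReal (Real.exp (-(1 / (4 * Fintype.card L) * (∑ p, ∑ i, ∑ j,
        if i = j then 0 else (gramEntry a x p i j ^ 2 -
          1 / 771 * (a p i j ^ 2 + 2 * Fintype.card L))))))) x ∂(gaussPi _) ≤ 1 := by
  classical
  set n : ℝ := ((Fintype.card L : ℕ) : ℝ) with hn
  have hn0 : 0 < n := by rw [hn]; exact_mod_cast Fintype.card_pos
  set N : ℝ := 2 ^ Fintype.card K with hN
  have hN0 : 0 < N := by positivity
  have hcardN : ((Finset.univ : Finset (Finset K)).card : ℝ) = N := by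
    simp [hN]
  set Φ : Finset K → (P × Bool × K × L → ℝ) → ℝ := fun I x => ∑ p, ∑ i, ∑ j,
        if i ∈ I ∧ j ∉ I then gramEntry a x p i j ^ 2 else 0 with hΦ
  set B : Finset K → ℝ := fun I => 1 / (771 * n) * ∑ p : P, ∑ i, ∑ j,
        if i ∈ I ∧ j ∉ I then (a p i j ^ 2 + 2 * n) else 0 with hB
  have hpt : ∀ x : P × Bool × K × L → ℝ,
      Real.exp (-(1 / (4 * n) * (∑ p, ∑ i, ∑ j,
        if i = j then 0 else (gramEntry a x p i j ^ 2 -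
          1 / 771 * (a p i j ^ 2 + 2 * n))))) ≤
      ∑ I : Finset K, (1 / N * Real.exp (B I)) * Real.exp (-(1 / n * Φ I x)) := by
    intro x
    have hj := convexOn_exp.map_sum_le (t := Finset.univ) (w := fun _ : Finset K => 1 / N)
      (p := fun I => B I - 1 / n * Φ I x) (fun _ _ => by positivity)
      (by rw [Finset.sum_const, nsmul_eq_mul, hcardN]; field_simp) (fun _ _ => Set.mem_univ _)
    have hl : ∑ I : Finset K, (1 / N) • (B I - 1 / n * Φ I x) =
        -(1 / (4 * n) * (∑ p, ∑ i, ∑ j,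
        if i = j then 0 else (gramEntry a x p i j ^ 2 -
          1 / 771 * (a p i j ^ 2 + 2 * n)))) := by
      have h1 : ∑ I, Φ I x = N / 4 * ∑ p, ∑ i, ∑ j,
          if i = j then 0 else gramEntry a x p i j ^ 2 := by
        simp only [hΦ]
        rw [Finset.sum_comm, Finset.mul_sum]
        exact Finset.sum_congr rfl fun p _ => sum_finset_cross_eq _
      have h2 : ∑ I, B I = 1 / (771 * n) * (N / 4 * ∑ p, ∑ i, ∑ j,
          if i = j then 0 else (a p i j ^ 2 + 2 * n)) := by
        simp only [hB]
        rw [← Finset.mul_sum, Finset.sum_comm, Finset.mul_sum (a := N / 4)]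
        congr 1
        exact Finset.sum_congr rfl fun p _ => sum_finset_cross_eq _
      have h3 : (∑ p, ∑ i, ∑ j, if i = j then 0 else (gramEntry a x p i j ^ 2 -
          1 / 771 * (a p i j ^ 2 + 2 * n))) = (∑ p, ∑ i, ∑ j,
          if i = j then 0 else gramEntry a x p i j ^ 2) - 1 / 771 * (∑ p, ∑ i, ∑ j,
          if i = j then 0 else (a p i j ^ 2 + 2 * n)) := by
        simp only [Finset.mul_sum, ← Finset.sum_sub_distrib]
        refine Finset.sum_congr rfl fun p _ => Finset.sum_congr rfl fun i _ =>
          Finset.sum_congr rfl fun j _ => ?_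
        split_ifs <;> simp
      simp only [smul_eq_mul]
      have h4 : ∑ I, 1 / N * (B I - 1 / n * Φ I x) = 1 / N * (∑ I, B I - 1 / n * ∑ I, Φ I x) := by
        rw [Finset.mul_sum (a := 1 / n), ← Finset.sum_sub_distrib, Finset.mul_sum]
      rw [h4, h1, h2, h3]
      field_simp
      ring
    rw [hl] at hj
    refine hj.trans (le_of_eq ?_)
    refine Finset.sum_congr rfl fun I _ => ?_
    rw [smul_eq_mul, sub_eq_add_neg, Real.exp_add, mul_assoc]
  have hcont : ∀ I, Continuous fun x : P × Bool × K × L → ℝ => Real.exp (-(1 / n * Φ I x)) := by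
    intro I
    have : ∀ p i j, Continuous fun x : P × Bool × K × L → ℝ =>
        (if i ∈ I ∧ j ∉ I then gramEntry a x p i j ^ 2 else 0) := by
      intro p i j
      split_ifs
      · simp only [gramEntry]; fun_prop
      · exact continuous_const
    fun_prop
  have hmeas := fun I => (hcont I).measurable.ennreal_ofReal.indicator
    (measurableSet_rowsBounded (P := P) (K := K) (L := L) (64 * n))
  calc _ ≤ ∫⁻ x, ∑ I : Finset K, ENNReal.ofReal (1 / N * Real.exp (B I)) *
          {x : P × Bool × K × L → ℝ | RowsBounded (64 * n) x}.indicator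
            (fun x => ENNReal.ofReal (Real.exp (-(1 / n * Φ I x)))) x ∂(gaussPi _) := by
        refine lintegral_mono fun x => ?_
        by_cases hx : RowsBounded (64 * n) x
        · simp only [Set.mem_ofPred_eq, hx, Set.indicator_of_mem]
          simp only [← ENNReal.ofReal_mul (show 0 ≤ 1 / N * Real.exp (B _) by positivity)]
          rw [← ENNReal.ofReal_sum_of_nonneg (fun I _ => by positivity)]
          exact ENNReal.ofReal_le_ofReal (hpt x)
        · simp [hx]
    _ = ∑ I : Finset K, ENNReal.ofReal (1 / N * Real.exp (B I)) *
          ∫⁻ x, {x : P × Bool × K × L → ℝ | RowsBounded (64 * n) x}.indicator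
            (fun x => ENNReal.ofReal (Real.exp (-(1 / n * Φ I x)))) x ∂(gaussPi _) := by
        rw [lintegral_finsetSum _ fun I _ => (hmeas I).const_mul _]
        exact Finset.sum_congr rfl fun I _ => lintegral_const_mul _ (hmeas I)
    _ ≤ ∑ I : Finset K, ENNReal.ofReal (1 / N * Real.exp (B I)) *
          ENNReal.ofReal (Real.exp (-(B I))) :=
        Finset.sum_le_sum fun I _ => mul_le_mul_right (lintegral_exp_neg_block_le hKL a I) _
    _ = 1 := by
        simp only [← ENNReal.ofReal_mul (show 0 ≤ 1 / N * Real.exp (B _) by positivity),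
          mul_assoc, ← Real.exp_add, add_neg_cancel, Real.exp_zero, mul_one]
        rw [Finset.sum_const, nsmul_eq_mul]
        have : ((Finset.univ : Finset (Finset K)).card : ENNReal) = ENNReal.ofReal N := by
          rw [← hcardN, ENNReal.ofReal_natCast]
        rw [this, ← ENNReal.ofReal_mul hN0.le]
        simp [hN0.ne']

end Chernoff

lemma card_mul_le_of_pairwise_separated {E : Type*} [NormedAddCommGroup E] [NormedSpace ℝ E]
    [FiniteDimensional ℝ E] {R ε : ℝ} (hε : 0 < ε) (hR : 0 ≤ R) (s : Finset E)
    (hs : ∀ c ∈ s, ‖c‖ ≤ R) (h : ∀ c ∈ s, ∀ d ∈ s, c ≠ d → ε ≤ ‖c - d‖) :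
    (s.card : ℝ) ≤ (1 + 2 * R / ε) ^ Module.finrank ℝ E := by
  borelize E
  let μ : Measure E := Measure.addHaar
  have hδ : 0 < ε / 2 := by positivity
  have hρ : 0 < R + ε / 2 := by positivity
  have hdisj : (s : Set E).PairwiseDisjoint fun c => Metric.ball c (ε / 2) := by
    intro c hc d hd hcd
    apply Metric.ball_disjoint_ball
    rw [dist_eq_norm, add_halves]
    exact h c hc d hd hcd
  have hsub : (⋃ c ∈ s, Metric.ball c (ε / 2)) ⊆ Metric.ball (0 : E) (R + ε / 2) := by
    refine Set.iUnion₂_subset fun x hx => Metric.ball_subset_ball' ?_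
    rw [dist_zero_right, add_comm]
    gcongr
    exact hs x hx
  have hvol := measure_mono (μ := μ) hsub
  rw [measure_biUnion_finset hdisj fun c _ => measurableSet_ball] at hvol
  simp only [μ.addHaar_ball_of_pos _ hδ, μ.addHaar_ball_of_pos _ hρ, Finset.sum_const,
    nsmul_eq_mul, ← mul_assoc] at hvol
  have hJ := (ENNReal.mul_le_mul_iff_left (Metric.measure_ball_pos μ (0 : E) zero_lt_one).ne'
    measure_ball_lt_top.ne).1 hvol
  have hK := ENNReal.toReal_le_of_le_ofReal (pow_nonneg hρ.le _) hJ
  rw [ENNReal.toReal_mul, ENNReal.toReal_natCast, ENNReal.toReal_ofReal (by positivity),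
    ← le_div_iff₀ (by positivity), ← div_pow] at hK
  refine hK.trans (le_of_eq ?_)
  congr 1
  field_simp
  ring

lemma exists_finset_net_of_norm_le {E : Type*} [NormedAddCommGroup E] [NormedSpace ℝ E]
    [FiniteDimensional ℝ E] {R ε : ℝ} (hε : 0 < ε) (hR : 0 ≤ R) (S : Set E)
    (hS : ∀ x ∈ S, ‖x‖ ≤ R) :
    ∃ t : Finset E, ↑t ⊆ S ∧ (∀ x ∈ S, ∃ y ∈ t, ‖x - y‖ ≤ ε) ∧
      (t.card : ℝ) ≤ (1 + 2 * R / ε) ^ Module.finrank ℝ E := by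
  classical
  set C : Set ℕ := {m | ∃ t : Finset E, ↑t ⊆ S ∧
    (∀ c ∈ t, ∀ d ∈ t, c ≠ d → ε ≤ ‖c - d‖) ∧ t.card = m}
  have hC : BddAbove C := by
    refine ⟨⌊(1 + 2 * R / ε) ^ Module.finrank ℝ E⌋₊, ?_⟩
    rintro m ⟨t, ht, hsep, rfl⟩
    exact Nat.le_floor (card_mul_le_of_pairwise_separated hε hR t (fun c hc => hS c (ht hc)) hsep)
  have hne : C.Nonempty := ⟨0, ∅, by simp, by simp, by simp⟩
  obtain ⟨t, ht, hsep, hcard⟩ := Nat.sSup_mem hne hC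
  refine ⟨t, ht, ?_, card_mul_le_of_pairwise_separated hε hR t (fun c hc => hS c (ht hc)) hsep⟩
  intro x hx
  by_contra! hcon
  have hxt : x ∉ t := fun h => by
    have := hcon x h
    simp at this
    linarith
  have hmem : (insert x t).card ∈ C := by
    refine ⟨insert x t, ?_, ?_, rfl⟩
    · intro y hy
      rcases Finset.mem_insert.1 hy with rfl | hy
      · exact hx
      · exact ht hy
    · intro c hc d hd hcd
      rcases Finset.mem_insert.1 hc with rfl | hct <;> rcases Finset.mem_insert.1 hd with rfl | hdt
      · exact absurd rfl hcd
      · exact (hcon d hdt).le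
      · rw [norm_sub_rev]; exact (hcon c hct).le
      · exact hsep c hct d hdt hcd
  have := le_csSup hC hmem
  rw [Finset.card_insert_of_notMem hxt, hcard] at this
  omega

lemma exists_finset_net {ι : Type*} [Fintype ι] {R ε : ℝ} (hε : 0 < ε) (hR : 0 ≤ R)
    (S : Set (ι → ℝ)) (hS : ∀ x ∈ S, ∑ i, x i ^ 2 ≤ R ^ 2) :
    ∃ t : Finset (ι → ℝ), ↑t ⊆ S ∧ (∀ x ∈ S, ∃ y ∈ t, ∑ i, (x i - y i) ^ 2 ≤ ε ^ 2) ∧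
      (t.card : ℝ) ≤ (1 + 2 * R / ε) ^ Fintype.card ι := by
  classical
  obtain ⟨t, ht, hcov, hcard⟩ := exists_finset_net_of_norm_le (E := EuclideanSpace ℝ ι) hε hR
    {x | x.ofLp ∈ S} (fun x hx => by
      rw [← Real.sqrt_sq hR, EuclideanSpace.norm_eq]
      apply Real.sqrt_le_sqrt
      simpa using hS x.ofLp hx)
  refine ⟨t.image WithLp.ofLp, ?_, ?_, ?_⟩
  · intro y hy
    obtain ⟨x, hx, rfl⟩ := Finset.mem_image.1 hy
    exact ht hx
  · intro x hx
    obtain ⟨y, hy, hxy⟩ := hcov (WithLp.toLp 2 x) hx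
    refine ⟨y.ofLp, Finset.mem_image_of_mem _ hy, ?_⟩
    have := pow_le_pow_left₀ (norm_nonneg _) hxy 2
    rwa [EuclideanSpace.real_norm_sq_eq] at this
  · rw [finrank_euclideanSpace] at hcard
    refine le_trans ?_ hcard
    exact_mod_cast Finset.card_image_le

lemma pi_map_uncurry {α β X : Type*} [Fintype α] [Fintype β] [MeasurableSpace X]
    (μ : Measure X) [SigmaFinite μ] :
    (Measure.pi fun _ : α => Measure.pi fun _ : β => μ).map (fun g (q : α × β) => g q.1 q.2) =
      Measure.pi fun _ : α × β => μ := by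
  have hm : Measurable fun (g : α → β → X) (q : α × β) => g q.1 q.2 := by
    refine measurable_pi_lambda _ fun q => ?_
    exact (measurable_pi_apply q.2).comp (measurable_pi_apply q.1)
  symm
  refine Measure.pi_eq fun s hs => ?_
  rw [Measure.map_apply hm (MeasurableSet.univ_pi hs)]
  have : (fun (g : α → β → X) (q : α × β) => g q.1 q.2) ⁻¹' Set.univ.pi s =
      Set.univ.pi fun a => Set.univ.pi fun b => s (a, b) := by
    ext g
    simp [Set.mem_pi, Prod.forall]
  rw [this, Measure.pi_pi, Fintype.prod_prod_type]
  simp only [Measure.pi_pi]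

lemma gaussPi_sum_sq_ge_le {n : ℕ} :
    gaussPi (Fin n) {y | 16 * (n : ℝ) < ∑ i, y i ^ 2} ≤
      ENNReal.ofReal (Real.exp (-(4 * n)) * Real.sqrt 2 ^ n) := by
  have hq : ∀ z : ℝ, gaussianPDFReal 0 1 z • Real.exp (z ^ 2 / 4) =
      (Real.sqrt (2 * Real.pi))⁻¹ * Real.exp (-(1 / 4) * z ^ 2) := by
    intro z
    rw [gaussianPDFReal, smul_eq_mul, mul_assoc, ← Real.exp_add]
    simp only [NNReal.coe_one, mul_one]
    congr 2
    ring
  have h1 : ∫ z, Real.exp (z ^ 2 / 4) ∂(gaussianReal 0 1) = Real.sqrt 2 := by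
    rw [integral_gaussianReal_eq_integral_smul (by norm_num)]
    simp_rw [hq]
    rw [integral_const_mul, integral_gaussian, show Real.pi / (1 / 4) = 2 * (2 * Real.pi) by ring,
      Real.sqrt_mul (by norm_num) (2 * Real.pi)]
    have : Real.sqrt (2 * Real.pi) ≠ 0 := by positivity
    field_simp
  have h2 : Integrable (fun z => Real.exp (z ^ 2 / 4)) (gaussianReal 0 1) := by
    apply Integrable.of_integral_ne_zero
    rw [h1]; positivity
  have h3 := Integrable.fintype_prod (ι := Fin n) (μ := fun _ => gaussianReal 0 1)
    (f := fun _ z => Real.exp (z ^ 2 / 4)) (fun _ => h2)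
  have h4 := integral_fintype_prod_eq_prod (ι := Fin n) (μ := fun _ => gaussianReal 0 1)
    (f := fun _ z => Real.exp (z ^ 2 / 4))
  simp only [h1, Finset.prod_const, Finset.card_univ, Fintype.card_fin] at h4
  have h5 := ofReal_integral_eq_lintegral_ofReal h3
    (Filter.Eventually.of_forall fun y => Finset.prod_nonneg fun i _ => (Real.exp_pos _).le)
  rw [h4] at h5
  calc _ ≤ ∫⁻ y : Fin n → ℝ, ENNReal.ofReal (Real.exp (-(4 * n))) *
        ENNReal.ofReal (∏ i, Real.exp (y i ^ 2 / 4)) ∂(gaussPi (Fin n)) := by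
        rw [← lintegral_indicator_one (measurableSet_lt (by fun_prop) (by fun_prop))]
        refine lintegral_mono fun y => ?_
        by_cases hy : 16 * (n : ℝ) < ∑ i, y i ^ 2
        · simp only [Set.mem_ofPred_eq, hy, Set.indicator_of_mem, Pi.one_apply]
          rw [← ENNReal.ofReal_mul (Real.exp_pos _).le, ← Real.exp_sum, ← Real.exp_add,
            ← Finset.sum_div, ENNReal.one_le_ofReal]
          apply Real.one_le_exp
          linarith
        · simp [hy]
    _ = _ := by
        rw [lintegral_const_mul _ (by fun_prop), ← h5, ← ENNReal.ofReal_mul (Real.exp_pos _).le]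

lemma sum_sq_le_of_net {n : ℕ} (M : Matrix (Fin n) (Fin n) ℝ) (t : Finset (Fin n → ℝ))
    (hcov : ∀ x : Fin n → ℝ, ∑ i, x i ^ 2 = 1 → ∃ y ∈ t, ∑ i, (x i - y i) ^ 2 ≤ (1 / 2) ^ 2)
    {Γ : ℝ} (hΓ : 0 ≤ Γ) (ht : ∀ y ∈ t, ∑ i, (M *ᵥ y) i ^ 2 ≤ Γ) (v : Fin n → ℝ) :
    ∑ i, (M *ᵥ v) i ^ 2 ≤ 4 * Γ * ∑ i, v i ^ 2 := by
  set T : EuclideanSpace ℝ (Fin n) →L[ℝ] EuclideanSpace ℝ (Fin n) :=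
    LinearMap.toContinuousLinearMap (Matrix.toEuclideanLin M)
  have hT : ∀ v, T v = WithLp.toLp 2 (M *ᵥ v.ofLp) := fun v => rfl
  have hsq : ∀ v : EuclideanSpace ℝ (Fin n), ‖T v‖ ^ 2 = ∑ i, (M *ᵥ v.ofLp) i ^ 2 := fun v => by
    rw [EuclideanSpace.real_norm_sq_eq]; rfl
  have hnorm : ‖T‖ ≤ 2 * Real.sqrt Γ := by
    have hunit : ∀ x : EuclideanSpace ℝ (Fin n), ‖x‖ = 1 → ‖T x‖ ≤ Real.sqrt Γ + ‖T‖ / 2 := by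
      intro x hx
      obtain ⟨y, hy, hxy⟩ := hcov x.ofLp (by
        rw [← EuclideanSpace.real_norm_sq_eq, hx]; norm_num)
      have h1 : ‖T (WithLp.toLp 2 y)‖ ≤ Real.sqrt Γ := by
        apply Real.le_sqrt_of_sq_le
        rw [hsq]
        exact ht y hy
      have h2 : ‖x - WithLp.toLp 2 y‖ ≤ 1 / 2 := by
        apply le_of_sq_le_sq _ (by norm_num)
        rw [EuclideanSpace.real_norm_sq_eq]
        exact hxy
      have h3 : ‖T (x - WithLp.toLp 2 y)‖ ≤ ‖T‖ * (1 / 2) :=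
        (T.le_opNorm _).trans (by gcongr)
      calc ‖T x‖ = ‖T (WithLp.toLp 2 y) + T (x - WithLp.toLp 2 y)‖ := by
            rw [← map_add]; simp
        _ ≤ _ := (norm_add_le _ _).trans (by linarith)
    have : ‖T‖ ≤ Real.sqrt Γ + ‖T‖ / 2 :=
      T.opNorm_le_of_unit_norm (by positivity) hunit
    linarith
  have h := T.le_opNorm (WithLp.toLp 2 v)
  have h2 := pow_le_pow_left₀ (norm_nonneg _) (h.trans
    (mul_le_mul_of_nonneg_right hnorm (norm_nonneg _))) 2
  rw [hsq, mul_pow, mul_pow, Real.sq_sqrt hΓ, EuclideanSpace.real_norm_sq_eq] at h2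
  norm_num at h2
  exact h2

lemma gaussMatrices_map_mulVec {E n : ℕ} {κ : Type*} [Fintype κ] [DecidableEq κ]
    (B : Matrix κ ((Fin E × Fin n) × Fin n) ℝ) (hB : B * Bᵀ = 1) :
    (gaussMatrices E n).map (fun g => B *ᵥ fun q => g q.1.1 q.1.2 q.2) = gaussPi κ := by
  have h1 : Measurable fun (g : Fin E → Fin n → Fin n → ℝ) (q : Fin E × Fin n) => g q.1 q.2 :=
    measurable_pi_lambda _ fun q => (measurable_pi_apply q.2).comp (measurable_pi_apply q.1)
  have h2 : Measurable fun (g : Fin E × Fin n → Fin n → ℝ) (q : (Fin E × Fin n) × Fin n) =>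
      g q.1 q.2 :=
    measurable_pi_lambda _ fun q => (measurable_pi_apply q.2).comp (measurable_pi_apply q.1)
  have h3 : Measurable fun x : (Fin E × Fin n) × Fin n → ℝ => B *ᵥ x := by
    refine measurable_pi_lambda _ fun i => ?_
    simp only [Matrix.mulVec, dotProduct]
    fun_prop
  rw [← gaussPi_map_mulVec B hB, gaussPi, ← pi_map_uncurry (gaussianReal 0 1),
    ← pi_map_uncurry (Measure.pi fun _ : Fin n => gaussianReal 0 1),
    Measure.map_map h2 h1, Measure.map_map h3 (h2.comp h1)]
  rfl

lemma gaussMatrices_map_apply_mulVec {E n : ℕ} (e : Fin E) {v : Fin n → ℝ}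
    (hv : ∑ i, v i ^ 2 = 1) :
    (gaussMatrices E n).map (fun g => Matrix.of (g e) *ᵥ v) = gaussPi (Fin n) := by
  rw [← gaussMatrices_map_mulVec (E := E)
    (Matrix.of fun (i : Fin n) q => if q.1 = (e, i) then v q.2 else 0)]
  · congr 1
    ext g i
    simp only [Matrix.mulVec, dotProduct, Matrix.of_apply]
    rw [Fintype.sum_prod_type, Finset.sum_eq_single (e, i) (by intro q _ hq; simp [hq]) (by simp)]
    simp [mul_comm]
  · ext i j
    simp only [Matrix.mul_apply, Matrix.transpose_apply, Matrix.one_apply, Matrix.of_apply]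
    rw [Fintype.sum_prod_type, Finset.sum_eq_single (e, i) (by intro q _ hq; simp [hq]) (by simp)]
    by_cases h : i = j
    · simp [h, ← pow_two, hv]
    · simp [h]

/-- All matrices `g e` have squared operator norm at most `Γ`. -/
def AllBounded {E n : ℕ} (Γ : ℝ) (g : Fin E → Fin n → Fin n → ℝ) : Prop :=
  ∀ e (v : Fin n → ℝ), ∑ i, (Matrix.of (g e) *ᵥ v) i ^ 2 ≤ Γ * ∑ i, v i ^ 2

lemma five_mul_sqrt_two_le_exp_two : 5 * Real.sqrt 2 ≤ Real.exp 2 := by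
  have h1 : Real.sqrt 2 ≤ 1.4143 := by
    rw [Real.sqrt_le_left (by norm_num)]; norm_num
  have h2 : Real.exp 2 = Real.exp 1 ^ 2 := by rw [← Real.exp_nat_mul]; norm_num
  have h3 := Real.exp_one_gt_d9
  rw [h2]
  nlinarith

lemma gaussMatrices_not_allBounded_le (E n : ℕ) :
    gaussMatrices E n {g | ¬ AllBounded (64 * n) g} ≤
      ENNReal.ofReal (E * Real.exp (-(2 * n))) := by
  obtain ⟨t, ht, hcov, hcard⟩ := exists_finset_net (ι := Fin n) (R := 1) (ε := 1 / 2)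
    (by norm_num) (by norm_num) {x | ∑ i, x i ^ 2 = 1} (fun x hx => by
      rw [Set.mem_ofPred_eq] at hx; rw [hx]; norm_num)
  have hsub : {g | ¬ AllBounded (64 * n) g} ⊆ ⋃ e : Fin E, ⋃ y ∈ t,
      {g : Fin E → Fin n → Fin n → ℝ | 16 * (n : ℝ) < ∑ i, (Matrix.of (g e) *ᵥ y) i ^ 2} := by
    intro g hg
    by_contra hcon
    simp only [Set.mem_iUnion, Set.mem_ofPred_eq, not_exists, not_lt] at hcon
    refine hg fun e v => ?_
    have := sum_sq_le_of_net (Matrix.of (g e)) t (fun x hx => hcov x hx) (by positivity)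
      (fun y hy => hcon e y hy) v
    linarith
  have hone : ∀ e : Fin E, ∀ y ∈ t, gaussMatrices E n
      {g | 16 * (n : ℝ) < ∑ i, (Matrix.of (g e) *ᵥ y) i ^ 2} ≤
      ENNReal.ofReal (Real.exp (-(4 * n)) * Real.sqrt 2 ^ n) := by
    intro e y hy
    have hm : Measurable fun g : Fin E → Fin n → Fin n → ℝ => Matrix.of (g e) *ᵥ y := by
      refine measurable_pi_lambda _ fun i => ?_
      simp only [Matrix.mulVec, dotProduct, Matrix.of_apply]
      fun_prop
    have := gaussPi_sum_sq_ge_le (n := n)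
    rwa [← gaussMatrices_map_apply_mulVec e (ht hy), Measure.map_apply hm
      (measurableSet_lt (by fun_prop) (by fun_prop))] at this
  refine (measure_mono hsub).trans ((measure_iUnion_fintype_le _ _).trans ?_)
  calc _ ≤ ∑ e : Fin E, ∑ y ∈ t, ENNReal.ofReal (Real.exp (-(4 * n)) * Real.sqrt 2 ^ n) :=
        Finset.sum_le_sum fun e _ => (measure_biUnion_finset_le _ _).trans
          (Finset.sum_le_sum fun y hy => hone e y hy)
    _ = ENNReal.ofReal (E * (t.card * (Real.exp (-(4 * n)) * Real.sqrt 2 ^ n))) := by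
        rw [Finset.sum_const, Finset.sum_const, nsmul_eq_mul, nsmul_eq_mul, Finset.card_univ,
          Fintype.card_fin, ENNReal.ofReal_mul E.cast_nonneg, ENNReal.ofReal_mul t.card.cast_nonneg,
          ENNReal.ofReal_natCast, ENNReal.ofReal_natCast]
    _ ≤ _ := by
        apply ENNReal.ofReal_le_ofReal
        gcongr
        have h5 : (t.card : ℝ) ≤ 5 ^ n := by
          refine hcard.trans (le_of_eq ?_)
          norm_num
        calc _ ≤ (5 : ℝ) ^ n * (Real.exp (-(4 * n)) * Real.sqrt 2 ^ n) := by gcongr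
          _ = (5 * Real.sqrt 2) ^ n * Real.exp (-(4 * n)) := by rw [mul_pow]; ring
          _ ≤ Real.exp 2 ^ n * Real.exp (-(4 * n)) := by
              gcongr
              exact five_mul_sqrt_two_le_exp_two
          _ = _ := by
              rw [← Real.exp_nat_mul, ← Real.exp_add]
              congr 1; ring

lemma sum_mulVec_sq_le {k n : ℕ} (Q : Matrix (Fin k) (Fin n) ℝ) (hQ : Q * Qᵀ = 1)
    (w : Fin n → ℝ) : ∑ j, (Q *ᵥ w) j ^ 2 ≤ ∑ i, w i ^ 2 := by
  have h0 : 0 ≤ (w - Qᵀ *ᵥ (Q *ᵥ w)) ⬝ᵥ (w - Qᵀ *ᵥ (Q *ᵥ w)) := by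
    simp only [dotProduct, ← pow_two]; positivity
  have h1 : (Qᵀ *ᵥ (Q *ᵥ w)) ⬝ᵥ (Qᵀ *ᵥ (Q *ᵥ w)) = (Q *ᵥ w) ⬝ᵥ (Q *ᵥ w) := by
    rw [Matrix.dotProduct_mulVec, Matrix.vecMul_transpose, Matrix.mulVec_mulVec, hQ,
      Matrix.one_mulVec]
  have h2 : w ⬝ᵥ (Qᵀ *ᵥ (Q *ᵥ w)) = (Q *ᵥ w) ⬝ᵥ (Q *ᵥ w) := by
    rw [Matrix.dotProduct_mulVec, Matrix.vecMul_transpose]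
  rw [sub_dotProduct, dotProduct_sub, dotProduct_sub, h1, h2, dotProduct_comm (Qᵀ *ᵥ _) w, h2] at h0
  simp only [dotProduct, ← pow_two] at h0
  linarith

/-- The rows of the products `Q * g e`, with the environments `e` listed by `idx`. -/
noncomputable def projRows {E k n m : ℕ} (idx : Fin m × Bool → Fin E)
    (Q : Matrix (Fin k) (Fin n) ℝ) (g : Fin E → Fin n → Fin n → ℝ) :
    Fin m × Bool × Fin k × Fin n → ℝ :=
  fun c => (Q * Matrix.of (g (idx (c.1, c.2.1)))) c.2.2.1 c.2.2.2

lemma gaussMatrices_map_projRows {E k n m : ℕ} {idx : Fin m × Bool → Fin E}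
    (hidx : Function.Injective idx) {Q : Matrix (Fin k) (Fin n) ℝ} (hQ : Q * Qᵀ = 1) :
    (gaussMatrices E n).map (projRows idx Q) = gaussPi _ := by
  rw [← gaussMatrices_map_mulVec (E := E) (n := n)
    (Matrix.of fun (c : Fin m × Bool × Fin k × Fin n) q =>
      if q.1.1 = idx (c.1, c.2.1) ∧ q.2 = c.2.2.2 then Q c.2.2.1 q.1.2 else 0)]
  · congr 1
    ext g ⟨p, b, i, l⟩
    simp only [Matrix.mulVec, dotProduct, projRows, Matrix.mul_apply, Matrix.of_apply]
    rw [Fintype.sum_prod_type, Fintype.sum_prod_type, Finset.sum_eq_single (idx (p, b))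
      (by intro q _ hq; simp [hq]) (by simp)]
    simp
  · ext ⟨p, b, i, l⟩ ⟨p', b', i', l'⟩
    simp only [Matrix.mul_apply, Matrix.transpose_apply, Matrix.one_apply, Matrix.of_apply]
    rw [Fintype.sum_prod_type, Fintype.sum_prod_type, Finset.sum_eq_single (idx (p, b))
      (by intro q _ hq; simp [hq]) (by simp)]
    have hii : ∑ r, Q i r * Q i' r = if i = i' then 1 else 0 := by
      have := congrFun (congrFun hQ i) i'
      simpa [Matrix.mul_apply, Matrix.one_apply] using this
    by_cases h : idx (p, b) = idx (p', b')
    · obtain ⟨rfl, rfl⟩ := Prod.mk.inj (hidx h)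
      by_cases hl : l = l'
      · subst hl
        simp [hii]
      · simp [hl, Ne.symm hl]
    · have h' : ¬ (p = p' ∧ b = b') := by
        rintro ⟨rfl, rfl⟩; exact h rfl
      have h'' : ¬ (p = p' ∧ b = b' ∧ i = i' ∧ l = l') := fun hh => h' ⟨hh.1, hh.2.1⟩
      simp [h, h'']

lemma AllBounded.rowsBounded_projRows {E k n m : ℕ} {Γ : ℝ} {g : Fin E → Fin n → Fin n → ℝ}
    (hg : AllBounded Γ g) (idx : Fin m × Bool → Fin E) {Q : Matrix (Fin k) (Fin n) ℝ}
    (hQ : Q * Qᵀ = 1) : RowsBounded Γ (projRows idx Q g) := by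
  intro p b v
  refine le_trans (le_of_eq ?_) ((sum_mulVec_sq_le Q hQ _).trans (hg (idx (p, b)) v))
  refine Finset.sum_congr rfl fun j _ => ?_
  rw [Matrix.mulVec_mulVec]
  simp [projRows, Matrix.mulVec, dotProduct, mul_comm]

lemma dotProduct_mul_transpose_mulVec {k n : ℕ} (Q : Matrix (Fin k) (Fin n) ℝ)
    (G : Matrix (Fin n) (Fin n) ℝ) (i j : Fin k) :
    Q i ⬝ᵥ ((G * Gᵀ) *ᵥ Q j) = ∑ l, (Q * G) i l * (Q * G) j l := by
  rw [← Matrix.mulVec_mulVec, Matrix.dotProduct_mulVec, Matrix.mulVec_transpose]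
  rfl

/-- The difference `Δ p` perturbed by the Gaussian matrices of the two environments in the pair. -/
noncomputable def pertDiff {E n m : ℕ} (idx : Fin m × Bool → Fin E)
    (Δ : Fin m → Matrix (Fin n) (Fin n) ℝ) (g : Fin E → Fin n → Fin n → ℝ) (p : Fin m) :
    Matrix (Fin n) (Fin n) ℝ :=
  Δ p + (Matrix.of (g (idx (p, false))) * (Matrix.of (g (idx (p, false))))ᵀ -
    Matrix.of (g (idx (p, true))) * (Matrix.of (g (idx (p, true))))ᵀ)

/-- The sum over `p` and `i ≠ j` of `(q_iᵀ (Δ p) q_j)²`. -/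
noncomputable def offDiagEnergy {k n m : ℕ} (Δ : Fin m → Matrix (Fin n) (Fin n) ℝ)
    (Q : Matrix (Fin k) (Fin n) ℝ) : ℝ :=
  ∑ p, ∑ i, ∑ j, if i = j then 0 else (Q i ⬝ᵥ (Δ p *ᵥ Q j)) ^ 2

lemma gramEntry_projRows {E k n m : ℕ} (idx : Fin m × Bool → Fin E)
    (Δ : Fin m → Matrix (Fin n) (Fin n) ℝ) (g : Fin E → Fin n → Fin n → ℝ)
    (Q : Matrix (Fin k) (Fin n) ℝ) (p : Fin m) (i j : Fin k) :
    gramEntry (fun p i j => Q i ⬝ᵥ (Δ p *ᵥ Q j)) (projRows idx Q g) p i j =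
      Q i ⬝ᵥ (pertDiff idx Δ g p *ᵥ Q j) := by
  rw [pertDiff, Matrix.add_mulVec, Matrix.sub_mulVec, dotProduct_add, dotProduct_sub,
    dotProduct_mul_transpose_mulVec, dotProduct_mul_transpose_mulVec]
  simp [gramEntry, pairSign, projRows]
  ring

lemma sum_offDiag_const {k m : ℕ} (c : ℝ) :
    ∑ _p : Fin m, ∑ i : Fin k, ∑ j : Fin k, (if i = j then 0 else c) =
      m * (k * (k - 1) * c) := by
  have h : ∀ i : Fin k, ∑ j : Fin k, (if i = j then 0 else c) = (k - 1) * c := by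
    intro i
    have : ∀ j : Fin k, (if i = j then 0 else c) = c - if i = j then c else 0 := by
      intro j; split_ifs <;> simp
    simp only [this, Finset.sum_sub_distrib]
    simp
    ring
  simp only [h, Finset.sum_const, Finset.card_univ, Fintype.card_fin, nsmul_eq_mul, mul_assoc]

lemma gaussMatrices_offDiagEnergy_le {E k n m : ℕ} (hn : 0 < n) (hkn : k ≤ n)
    {idx : Fin m × Bool → Fin E} (hidx : Function.Injective idx)
    (Δ : Fin m → Matrix (Fin n) (Fin n) ℝ) {Q : Matrix (Fin k) (Fin n) ℝ} (hQ : Q * Qᵀ = 1) :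
    gaussMatrices E n {g | AllBounded (64 * n) g ∧ offDiagEnergy (pertDiff idx Δ g) Q ≤
        1 / 771 * (offDiagEnergy Δ Q + m * (k * (k - 1) * n))} ≤
      ENNReal.ofReal (Real.exp (-(1 / 3084 * (m * (k * (k - 1)))))) := by
  have hne : Nonempty (Fin n) := ⟨⟨0, hn⟩⟩
  have hn' : (0 : ℝ) < n := by exact_mod_cast hn
  set a : Fin m → Fin k → Fin k → ℝ := fun p i j => Q i ⬝ᵥ (Δ p *ᵥ Q j)
  set F : (Fin m × Bool × Fin k × Fin n → ℝ) → ℝ := fun x => ∑ p, ∑ i, ∑ j,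
        if i = j then 0 else (gramEntry a x p i j ^ 2 - 1 / 771 * (a p i j ^ 2 + 2 * n))
  have hmain := lintegral_exp_neg_offDiag_le (P := Fin m) (K := Fin k) (L := Fin n)
    (by simpa using hkn) a
  simp only [Fintype.card_fin] at hmain
  have hmp : Measurable (projRows idx Q) := by
    refine measurable_pi_lambda _ fun c => ?_
    simp only [projRows, Matrix.mul_apply, Matrix.of_apply]
    fun_prop
  have hFc : Continuous F := by
    have : ∀ p i j, Continuous fun x : Fin m × Bool × Fin k × Fin n → ℝ =>
        (if i = j then 0 else (gramEntry a x p i j ^ 2 - 1 / 771 * (a p i j ^ 2 + 2 * n))) := by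
      intro p i j
      split_ifs
      · exact continuous_const
      · simp only [gramEntry]; fun_prop
    fun_prop
  have hF : ∀ g, F (projRows idx Q g) = offDiagEnergy (pertDiff idx Δ g) Q -
      1 / 771 * (offDiagEnergy Δ Q + m * (k * (k - 1) * (2 * n))) := by
    intro g
    rw [← sum_offDiag_const]
    simp only [F, a, offDiagEnergy, gramEntry_projRows]
    rw [← Finset.sum_add_distrib, Finset.mul_sum, ← Finset.sum_sub_distrib]
    refine Finset.sum_congr rfl fun p _ => ?_
    rw [← Finset.sum_add_distrib, Finset.mul_sum, ← Finset.sum_sub_distrib]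
    refine Finset.sum_congr rfl fun i _ => ?_
    rw [← Finset.sum_add_distrib, Finset.mul_sum, ← Finset.sum_sub_distrib]
    refine Finset.sum_congr rfl fun j _ => ?_
    split_ifs <;> simp
  set T : ℝ := 1 / 771 * (m * (k * (k - 1) * n)) with hT
  have hsub : {g | AllBounded (64 * n) g ∧ offDiagEnergy (pertDiff idx Δ g) Q ≤
        1 / 771 * (offDiagEnergy Δ Q + m * (k * (k - 1) * n))} ⊆
      projRows (E := E) idx Q ⁻¹' {x | RowsBounded (64 * n) x ∧ F x ≤ -T} := by
    rintro g ⟨hg, hle⟩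
    refine ⟨hg.rowsBounded_projRows idx hQ, ?_⟩
    rw [hF]
    simp only [hT]
    linarith
  have hms : MeasurableSet {x | RowsBounded (64 * n) x ∧ F x ≤ -T} :=
    (measurableSet_rowsBounded _).inter (measurableSet_le hFc.measurable measurable_const)
  refine (measure_mono hsub).trans ?_
  rw [← Measure.map_apply hmp hms, gaussMatrices_map_projRows hidx hQ]
  calc _ ≤ ∫⁻ x, ENNReal.ofReal (Real.exp (-(1 / (4 * n) * T))) *
          {x : Fin m × Bool × Fin k × Fin n → ℝ | RowsBounded (64 * n) x}.indicator
            (fun x => ENNReal.ofReal (Real.exp (-(1 / (4 * n) * F x)))) x ∂(gaussPi _) := by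
        rw [← lintegral_indicator_one hms]
        refine lintegral_mono fun x => ?_
        by_cases hx : RowsBounded (64 * n) x ∧ F x ≤ -T
        · simp only [Set.mem_ofPred_eq, hx, Set.indicator_of_mem, Pi.one_apply, and_self]
          rw [← ENNReal.ofReal_mul (Real.exp_pos _).le, ← Real.exp_add, ENNReal.one_le_ofReal]
          apply Real.one_le_exp
          have : 1 / (4 * (n : ℝ)) * (F x + T) ≤ 0 :=
            mul_nonpos_of_nonneg_of_nonpos (by positivity) (by linarith [hx.2])
          linarith
        · simp [hx]
    _ ≤ ENNReal.ofReal (Real.exp (-(1 / (4 * n) * T))) * 1 := by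
        rw [lintegral_const_mul _ (Measurable.indicator (by fun_prop)
          (measurableSet_rowsBounded _))]
        gcongr
    _ = _ := by
        rw [mul_one, hT]
        congr 3
        field_simp
        ring

/-- The squared operator norm of `A` is at most `β`. -/
def SqBounded {n : ℕ} (β : ℝ) (A : Matrix (Fin n) (Fin n) ℝ) : Prop :=
  ∀ v : Fin n → ℝ, ∑ i, (A *ᵥ v) i ^ 2 ≤ β * ∑ i, v i ^ 2

lemma SqBounded.add {n : ℕ} {β γ : ℝ} {A B : Matrix (Fin n) (Fin n) ℝ} (hA : SqBounded β A)
    (hB : SqBounded γ B) : SqBounded (2 * β + 2 * γ) (A + B) := by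
  intro v
  calc _ ≤ ∑ i, (2 * (A *ᵥ v) i ^ 2 + 2 * (B *ᵥ v) i ^ 2) := by
        refine Finset.sum_le_sum fun i _ => ?_
        rw [Matrix.add_mulVec, Pi.add_apply]
        nlinarith [sq_nonneg ((A *ᵥ v) i - (B *ᵥ v) i)]
    _ = 2 * ∑ i, (A *ᵥ v) i ^ 2 + 2 * ∑ i, (B *ᵥ v) i ^ 2 := by
        rw [Finset.sum_add_distrib, Finset.mul_sum, Finset.mul_sum]
    _ ≤ _ := by linarith [hA v, hB v]

lemma SqBounded.neg {n : ℕ} {β : ℝ} {A : Matrix (Fin n) (Fin n) ℝ} (hA : SqBounded β A) :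
    SqBounded β (-A) := by
  intro v
  simpa [Matrix.neg_mulVec] using hA v

lemma SqBounded.sub {n : ℕ} {β γ : ℝ} {A B : Matrix (Fin n) (Fin n) ℝ} (hA : SqBounded β A)
    (hB : SqBounded γ B) : SqBounded (2 * β + 2 * γ) (A - B) := by
  rw [sub_eq_add_neg]
  exact hA.add hB.neg

lemma SqBounded.mul {n : ℕ} {β γ : ℝ} {A B : Matrix (Fin n) (Fin n) ℝ} (hβ : 0 ≤ β)
    (hA : SqBounded β A) (hB : SqBounded γ B) : SqBounded (β * γ) (A * B) := by
  intro v
  rw [← Matrix.mulVec_mulVec, mul_assoc]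
  exact (hA _).trans (mul_le_mul_of_nonneg_left (hB v) hβ)

lemma SqBounded.transpose {n : ℕ} {β : ℝ} {A : Matrix (Fin n) (Fin n) ℝ} (hβ : 0 ≤ β)
    (hA : SqBounded β A) : SqBounded β Aᵀ := by
  intro u
  set s := ∑ i, (Aᵀ *ᵥ u) i ^ 2 with hs
  have hs0 : 0 ≤ s := by positivity
  have h1 : s = ∑ i, u i * (A *ᵥ (Aᵀ *ᵥ u)) i := by
    have : (Aᵀ *ᵥ u) ⬝ᵥ (Aᵀ *ᵥ u) = u ⬝ᵥ (A *ᵥ (Aᵀ *ᵥ u)) := by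
      rw [Matrix.dotProduct_mulVec u, Matrix.mulVec_transpose]
    simpa [dotProduct, ← pow_two] using this
  have h2 := Finset.sum_mul_sq_le_sq_mul_sq Finset.univ u (A *ᵥ (Aᵀ *ᵥ u))
  rw [← h1] at h2
  have h3 := hA (Aᵀ *ᵥ u)
  have hu : 0 ≤ ∑ i, u i ^ 2 := by positivity
  rcases hs0.eq_or_lt with h | h
  · rw [← h]; positivity
  · have h4 : s * s ≤ (β * ∑ i, u i ^ 2) * s := by
      nlinarith [mul_le_mul_of_nonneg_left h3 hu]
    exact le_of_mul_le_mul_right h4 h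

lemma sqBounded_of_specNorm {n : ℕ} {D : ℝ} {A : Matrix (Fin n) (Fin n) ℝ}
    (hA : specNorm A ^ 2 ≤ D) : SqBounded D A := by
  have hbdd : BddAbove {c | ∃ v : Fin n → ℝ, (∑ i, v i ^ 2) = 1 ∧
      c = Real.sqrt (∑ i, (A *ᵥ v) i ^ 2)} := by
    refine ⟨Real.sqrt (∑ i, ∑ j, A i j ^ 2), ?_⟩
    rintro c ⟨v, hv, rfl⟩
    apply Real.sqrt_le_sqrt
    refine Finset.sum_le_sum fun i _ => ?_
    have := Finset.sum_mul_sq_le_sq_mul_sq Finset.univ (A i) v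
    rw [hv, mul_one] at this
    exact this
  intro v
  set s := ∑ i, v i ^ 2 with hs
  have hs0 : 0 ≤ s := by positivity
  rcases hs0.eq_or_lt with h | h
  · have hv : v = 0 := by
      ext i
      have := (Finset.sum_eq_zero_iff_of_nonneg (fun i _ => sq_nonneg (v i))).1 h.symm i
        (Finset.mem_univ i)
      simpa using this
    rw [← h, hv]
    simp
  · have hr : 0 < Real.sqrt s := Real.sqrt_pos.2 h
    have hr2 : Real.sqrt s ^ 2 = s := Real.sq_sqrt hs0
    have hu : ∑ i, ((Real.sqrt s)⁻¹ • v) i ^ 2 = 1 := by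
      simp only [Pi.smul_apply, smul_eq_mul, mul_pow, ← Finset.mul_sum, ← hs, inv_pow, hr2]
      field_simp
    have h1 := le_csSup hbdd ⟨_, hu, rfl⟩
    have h2 := (pow_le_pow_left₀ (Real.sqrt_nonneg _) h1 2).trans hA
    rw [Real.sq_sqrt (by positivity), Matrix.mulVec_smul] at h2
    simp only [Pi.smul_apply, smul_eq_mul, mul_pow, ← Finset.mul_sum, inv_pow, hr2] at h2
    rwa [inv_mul_le_iff₀ h, mul_comm s] at h2

lemma sum_sub_sq_le {k n : ℕ} {β : ℝ} (hβ : 0 ≤ β) {A : Matrix (Fin n) (Fin n) ℝ}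
    (hA : SqBounded β A) {Q Q' : Matrix (Fin k) (Fin n) ℝ} (hQ : Q * Qᵀ = 1) (hQ' : Q' * Q'ᵀ = 1) :
    ∑ i, ∑ j, (Q i ⬝ᵥ (A *ᵥ Q j) - Q' i ⬝ᵥ (A *ᵥ Q' j)) ^ 2 ≤
      4 * β * ∑ i, ∑ l, (Q i l - Q' i l) ^ 2 := by
  have h1 : ∑ i, ∑ j, ((Q i - Q' i) ⬝ᵥ (A *ᵥ Q j)) ^ 2 ≤ β * ∑ i, ∑ l, (Q i l - Q' i l) ^ 2 := by
    rw [Finset.mul_sum]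
    refine Finset.sum_le_sum fun i _ => ?_
    refine le_trans (le_of_eq ?_) ((sum_mulVec_sq_le Q hQ _).trans
      (hA.transpose hβ (Q i - Q' i)))
    refine Finset.sum_congr rfl fun j _ => ?_
    rw [Matrix.dotProduct_mulVec, ← Matrix.mulVec_transpose, dotProduct_comm]
    rfl
  have h2 : ∑ i, ∑ j, (Q' i ⬝ᵥ (A *ᵥ (Q j - Q' j))) ^ 2 ≤
      β * ∑ i, ∑ l, (Q i l - Q' i l) ^ 2 := by
    rw [Finset.mul_sum, Finset.sum_comm]
    exact Finset.sum_le_sum fun j _ => (sum_mulVec_sq_le Q' hQ' _).trans (hA (Q j - Q' j))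
  calc _ ≤ ∑ i, ∑ j, (2 * ((Q i - Q' i) ⬝ᵥ (A *ᵥ Q j)) ^ 2 +
        2 * (Q' i ⬝ᵥ (A *ᵥ (Q j - Q' j))) ^ 2) := by
        refine Finset.sum_le_sum fun i _ => Finset.sum_le_sum fun j _ => ?_
        have : Q i ⬝ᵥ (A *ᵥ Q j) - Q' i ⬝ᵥ (A *ᵥ Q' j) =
            (Q i - Q' i) ⬝ᵥ (A *ᵥ Q j) + Q' i ⬝ᵥ (A *ᵥ (Q j - Q' j)) := by
          rw [Matrix.mulVec_sub, dotProduct_sub, sub_dotProduct]; ring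
        rw [this]
        exact (add_sq_le).trans (le_of_eq (by ring))
    _ = 2 * ∑ i, ∑ j, ((Q i - Q' i) ⬝ᵥ (A *ᵥ Q j)) ^ 2 +
        2 * ∑ i, ∑ j, (Q' i ⬝ᵥ (A *ᵥ (Q j - Q' j))) ^ 2 := by
        simp only [Finset.sum_add_distrib, Finset.mul_sum]
    _ ≤ _ := by linarith

lemma offDiagEnergy_le_of_close {k n m : ℕ} {β δ : ℝ} (hβ : 0 ≤ β)
    {Δ : Fin m → Matrix (Fin n) (Fin n) ℝ} (hΔ : ∀ p, SqBounded β (Δ p))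
    {Q Q' : Matrix (Fin k) (Fin n) ℝ} (hQ : Q * Qᵀ = 1) (hQ' : Q' * Q'ᵀ = 1)
    (hclose : ∑ i, ∑ l, (Q i l - Q' i l) ^ 2 ≤ δ) :
    offDiagEnergy Δ Q' ≤ 2 * offDiagEnergy Δ Q + m * (8 * β * δ) := by
  have h : ∀ p, (∑ i, ∑ j, if i = j then 0 else (Q' i ⬝ᵥ (Δ p *ᵥ Q' j)) ^ 2) ≤
      2 * (∑ i, ∑ j, if i = j then 0 else (Q i ⬝ᵥ (Δ p *ᵥ Q j)) ^ 2) + 8 * β * δ := by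
    intro p
    have h1 := sum_sub_sq_le hβ (hΔ p) hQ hQ'
    have h2 : 4 * β * ∑ i, ∑ l, (Q i l - Q' i l) ^ 2 ≤ 4 * β * δ := by gcongr
    calc _ ≤ ∑ i, ∑ j, (2 * (if i = j then 0 else (Q i ⬝ᵥ (Δ p *ᵥ Q j)) ^ 2) +
          2 * (Q i ⬝ᵥ (Δ p *ᵥ Q j) - Q' i ⬝ᵥ (Δ p *ᵥ Q' j)) ^ 2) := by
          refine Finset.sum_le_sum fun i _ => Finset.sum_le_sum fun j _ => ?_
          split_ifs
          · positivity
          · nlinarith [sq_nonneg (2 * (Q i ⬝ᵥ (Δ p *ᵥ Q j)) - Q' i ⬝ᵥ (Δ p *ᵥ Q' j))]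
      _ = 2 * (∑ i, ∑ j, if i = j then 0 else (Q i ⬝ᵥ (Δ p *ᵥ Q j)) ^ 2) +
          2 * ∑ i, ∑ j, (Q i ⬝ᵥ (Δ p *ᵥ Q j) - Q' i ⬝ᵥ (Δ p *ᵥ Q' j)) ^ 2 := by
          simp only [Finset.sum_add_distrib, Finset.mul_sum]
      _ ≤ _ := by linarith
  calc _ ≤ ∑ p : Fin m, (2 * (∑ i, ∑ j, if i = j then 0 else (Q i ⬝ᵥ (Δ p *ᵥ Q j)) ^ 2) +
        8 * β * δ) := Finset.sum_le_sum fun p _ => h p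
    _ = _ := by
        rw [Finset.sum_add_distrib, ← Finset.mul_sum]
        simp [offDiagEnergy]

lemma AllBounded.sqBounded_pertDiff {E n m : ℕ} {D Γ : ℝ} (hΓ : 0 ≤ Γ)
    {g : Fin E → Fin n → Fin n → ℝ} (hg : AllBounded Γ g) (idx : Fin m × Bool → Fin E)
    {Δ : Fin m → Matrix (Fin n) (Fin n) ℝ} (hΔ : ∀ p, SqBounded (4 * D) (Δ p)) (p : Fin m) :
    SqBounded (8 * (D + Γ ^ 2)) (pertDiff idx Δ g p) := by
  have h1 : ∀ e, SqBounded (Γ * Γ) (Matrix.of (g e) * (Matrix.of (g e))ᵀ) := fun e =>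
    SqBounded.mul hΓ (hg e) (SqBounded.transpose hΓ (hg e))
  have := (hΔ p).add ((h1 (idx (p, false))).sub (h1 (idx (p, true))))
  rw [show 8 * (D + Γ ^ 2) = 2 * (4 * D) + 2 * (2 * (Γ * Γ) + 2 * (Γ * Γ)) by ring]
  exact this

lemma lt_offDiagEnergy_of_close {k n m : ℕ} (hk : 1 ≤ k) {D β δ : ℝ} (hD : 0 ≤ D) (hDβ : 4 * D ≤ β)
    {Δ Δ' : Fin m → Matrix (Fin n) (Fin n) ℝ} (hΔ : ∀ p, SqBounded (4 * D) (Δ p))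
    (hΔ' : ∀ p, SqBounded β (Δ' p))
    {Q Q' : Matrix (Fin k) (Fin n) ℝ} (hQ : Q * Qᵀ = 1) (hQ' : Q' * Q'ᵀ = 1) (hδ : 0 ≤ δ)
    (hclose : ∑ i, ∑ l, (Q i l - Q' i l) ^ 2 ≤ δ)
    (hβδ : β * δ ≤ 1 / 15420 * (k * (k - 1) * n))
    (h : 1 / 771 * (offDiagEnergy Δ Q' + m * (k * (k - 1) * n)) < offDiagEnergy Δ' Q') :
    1 / 3084 * (offDiagEnergy Δ Q + m * (k * (k - 1) * n)) < offDiagEnergy Δ' Q := by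
  have hclose' : ∑ i, ∑ l, (Q' i l - Q i l) ^ 2 ≤ δ := by
    refine le_trans (le_of_eq ?_) hclose
    refine Finset.sum_congr rfl fun i _ => Finset.sum_congr rfl fun l _ => by ring
  have h1 := offDiagEnergy_le_of_close (by linarith) hΔ' hQ hQ' hclose
  have h2 := offDiagEnergy_le_of_close (by linarith) hΔ hQ' hQ hclose'
  have h3 : (m : ℝ) * (8 * β * δ) ≤ m * (8 * (1 / 15420 * (k * (k - 1) * n))) := by
    rw [mul_assoc 8 β]
    gcongr
  have h4 : (m : ℝ) * (8 * (4 * D) * δ) ≤ m * (8 * β * δ) := by gcongr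
  have hk1 : (0 : ℝ) ≤ k - 1 := by
    have : (1 : ℝ) ≤ k := by exact_mod_cast hk
    linarith
  have hW : 0 ≤ (m : ℝ) * (k * (k - 1) * n) := by positivity
  have h5 : (m : ℝ) * (8 * (1 / 15420 * (k * (k - 1) * n))) =
      8 / 15420 * (m * (k * (k - 1) * n)) := by ring
  rw [h5] at h3
  generalize (m : ℝ) * (k * (k - 1) * n) = W at *
  generalize (m : ℝ) * (8 * β * δ) = T at *
  linarith

lemma exists_finset_net_orthonormal {k n : ℕ} (hk : 0 < k) {ε : ℝ} (hε : 0 < ε) :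
    ∃ t : Finset (Fin k × Fin n → ℝ),
      (∀ x ∈ t, Matrix.of (Function.curry x) * (Matrix.of (Function.curry x))ᵀ = 1) ∧
      (∀ Q : Matrix (Fin k) (Fin n) ℝ, Q * Qᵀ = 1 → ∃ x ∈ t,
        ∑ i, ∑ l, (Q i l - Matrix.of (Function.curry x) i l) ^ 2 ≤ ε ^ 2 * k) ∧
      (t.card : ℝ) ≤ (1 + 2 / ε) ^ (k * n) := by
  have hk' : (0 : ℝ) < k := by exact_mod_cast hk
  have hs : 0 < Real.sqrt k := Real.sqrt_pos.2 hk'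
  obtain ⟨t, ht, hcov, hcard⟩ := exists_finset_net (mul_pos hε hs) hs.le
    {x : Fin k × Fin n → ℝ |
      Matrix.of (Function.curry x) * (Matrix.of (Function.curry x))ᵀ = 1} (fun x hx => by
      rw [Real.sq_sqrt hk'.le, Fintype.sum_prod_type]
      refine le_of_eq ?_
      have h : ∀ i, ∑ l, x (i, l) ^ 2 = 1 := fun i => by
        have := congr_fun (congr_fun hx i) i
        simpa [Matrix.mul_apply, ← pow_two, Function.curry] using this
      simp [h])
  refine ⟨t, fun x hx => ht hx, fun Q hQ => ?_, ?_⟩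
  · obtain ⟨y, hy, hxy⟩ := hcov (Function.uncurry Q) hQ
    refine ⟨y, hy, ?_⟩
    rw [mul_pow, Real.sq_sqrt hk'.le, Fintype.sum_prod_type] at hxy
    exact hxy
  · refine hcard.trans (le_of_eq ?_)
    rw [Fintype.card_prod, Fintype.card_fin, Fintype.card_fin]
    congr 2
    field_simp

lemma isProbabilityMeasure_gaussMatrices (E n : ℕ) :
    IsProbabilityMeasure (gaussMatrices E n) := by
  unfold gaussMatrices
  infer_instance

lemma gaussMatrices_not_forall_lt_offDiagEnergy_le {E k n m : ℕ} (hk : 1 ≤ k) (hkn : k ≤ n)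
    {idx : Fin m × Bool → Fin E} (hidx : Function.Injective idx) {D ε : ℝ} (hD : 0 ≤ D)
    {Δ : Fin m → Matrix (Fin n) (Fin n) ℝ} (hΔ : ∀ p, SqBounded (4 * D) (Δ p)) (hε : 0 < ε)
    (hclose : 8 * (D + (64 * n) ^ 2) * (ε ^ 2 * k) ≤ 1 / 15420 * (k * (k - 1) * n)) :
    gaussMatrices E n {g | ¬ ∀ Q : Matrix (Fin k) (Fin n) ℝ, Q * Qᵀ = 1 →
      1 / 3084 * (offDiagEnergy Δ Q + m * (k * (k - 1) * n)) <
        offDiagEnergy (pertDiff idx Δ g) Q} ≤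
    ENNReal.ofReal (E * Real.exp (-(2 * n)) +
      (1 + 2 / ε) ^ (k * n) * Real.exp (-(1 / 3084 * (m * (k * (k - 1)))))) := by
  obtain ⟨t, ht, hcov, hcard⟩ := exists_finset_net_orthonormal (n := n) hk hε
  have hsub : {g : Fin E → Fin n → Fin n → ℝ | ¬ ∀ Q : Matrix (Fin k) (Fin n) ℝ, Q * Qᵀ = 1 →
      1 / 3084 * (offDiagEnergy Δ Q + m * (k * (k - 1) * n)) <
        offDiagEnergy (pertDiff idx Δ g) Q} ⊆
      {g | ¬ AllBounded (64 * n) g} ∪ ⋃ x ∈ t, {g | AllBounded (64 * n) g ∧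
        offDiagEnergy (pertDiff idx Δ g) (Matrix.of (Function.curry x)) ≤
          1 / 771 * (offDiagEnergy Δ (Matrix.of (Function.curry x)) +
            m * (k * (k - 1) * n))} := by
    intro g hg
    by_contra hcon
    simp only [Set.mem_union, Set.mem_ofPred_eq, Set.mem_iUnion, not_or, not_not, not_exists,
      not_and, not_le] at hcon
    refine hg fun Q hQ => ?_
    obtain ⟨x, hx, hQx⟩ := hcov Q hQ
    exact lt_offDiagEnergy_of_close hk hD (by nlinarith [sq_nonneg (64 * (n : ℝ))]) hΔ
      (fun p => hcon.1.sqBounded_pertDiff (by positivity) idx hΔ p) hQ (ht x hx) (by positivity)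
      hQx hclose (hcon.2 x hx hcon.1)
  refine (measure_mono hsub).trans ((measure_union_le _ _).trans ?_)
  rw [ENNReal.ofReal_add (by positivity) (by positivity)]
  refine add_le_add (gaussMatrices_not_allBounded_le E n) ?_
  refine (measure_biUnion_finset_le _ _).trans ((Finset.sum_le_sum fun x hx =>
    gaussMatrices_offDiagEnergy_le (lt_of_lt_of_le hk hkn) hkn hidx Δ (ht x hx)).trans ?_)
  rw [Finset.sum_const, nsmul_eq_mul, ← ENNReal.ofReal_natCast,
    ← ENNReal.ofReal_mul (Nat.cast_nonneg _)]
  exact ENNReal.ofReal_le_ofReal (mul_le_mul_of_nonneg_right hcard (Real.exp_pos _).le)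

/-- With `a = k - 1`. -/
lemma net_resolution_le {D a n M : ℝ} (ha : 0 < a) (hn : 0 < n) (hM : 1 ≤ M)
    (hD : D ≤ a * n * Real.exp M) (hna : n ≤ a * Real.exp M) :
    8 * (D + (64 * n) ^ 2) * Real.exp (-(12 * M)) ^ 2 ≤ 1 / 15420 * (a * n) := by
  have h1 : D + (64 * n) ^ 2 ≤ 4097 * (a * n * Real.exp M) := by nlinarith
  have h2 : (505405920 : ℝ) ≤ Real.exp (23 * M) := by
    have h3 : (2.7 : ℝ) ^ 23 ≤ Real.exp 1 ^ 23 :=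
      pow_le_pow_left₀ (by norm_num) (by linarith [Real.exp_one_gt_d9]) _
    rw [← Real.exp_nat_mul] at h3
    have h4 : Real.exp ((23 : ℕ) * 1) ≤ Real.exp (23 * M) := by
      apply Real.exp_le_exp.2; push_cast; linarith
    refine le_trans ?_ (h3.trans h4)
    norm_num
  have h5 : Real.exp M * Real.exp (-(12 * M)) ^ 2 = (Real.exp (23 * M))⁻¹ := by
    rw [← Real.exp_nat_mul, ← Real.exp_add, ← Real.exp_neg]; congr 1; push_cast; ring
  calc 8 * (D + (64 * n) ^ 2) * Real.exp (-(12 * M)) ^ 2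
      ≤ 8 * (4097 * (a * n * Real.exp M)) * Real.exp (-(12 * M)) ^ 2 := by gcongr
    _ = 32776 * (a * n) * (Real.exp M * Real.exp (-(12 * M)) ^ 2) := by ring
    _ ≤ 32776 * (a * n) * (505405920 : ℝ)⁻¹ := by rw [h5]; gcongr
    _ = _ := by ring

lemma net_card_mul_exp_le {k n : ℕ} {M r : ℝ} (hk : 1 ≤ k) (hM : 1 ≤ M)
    (hr : 15 * (k * n * M) ≤ r) :
    (1 + 2 / Real.exp (-(12 * M))) ^ (k * n) * Real.exp (-r) ≤ Real.exp (-n) := by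
  have h1 : 1 + 2 / Real.exp (-(12 * M)) ≤ Real.exp (14 * M) := by
    rw [Real.exp_neg, div_inv_eq_mul]
    have h2 : 1 ≤ Real.exp (12 * M) := Real.one_le_exp (by linarith)
    have h3 : 3 ≤ Real.exp (2 * M) := by linarith [Real.add_one_le_exp (2 * M)]
    rw [show 14 * M = 2 * M + 12 * M by ring, Real.exp_add]
    nlinarith
  have hk' : (1 : ℝ) ≤ k := by exact_mod_cast hk
  have hn0 : (0 : ℝ) ≤ n := n.cast_nonneg
  have hknM : (n : ℝ) ≤ k * n * M := by
    nlinarith [mul_nonneg (sub_nonneg.2 hk') hn0,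
      mul_nonneg (mul_nonneg (by linarith : (0 : ℝ) ≤ k) hn0) (sub_nonneg.2 hM)]
  have h0 : 0 < Real.exp (-(12 * M)) := Real.exp_pos _
  calc (1 + 2 / Real.exp (-(12 * M))) ^ (k * n) * Real.exp (-r)
      ≤ Real.exp (14 * M) ^ (k * n) * Real.exp (-r) := by gcongr
    _ = Real.exp (14 * (k * n * M) - r) := by
        rw [← Real.exp_nat_mul, ← Real.exp_add]; congr 1; push_cast; ring
    _ ≤ _ := Real.exp_le_exp.2 (by linarith)

lemma natCast_mul_exp_neg_le {E n : ℕ} (hEn : (E : ℝ) ≤ n) :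
    E * Real.exp (-(2 * n)) ≤ Real.exp (-(n : ℝ)) := by
  have h1 : (E : ℝ) ≤ Real.exp n := by linarith [Real.add_one_le_exp (n : ℝ)]
  calc E * Real.exp (-(2 * n)) ≤ Real.exp n * Real.exp (-(2 * n)) := by gcongr
    _ = _ := by rw [← Real.exp_add]; congr 1; ring

/-- The index of environment `2 p` (for `false`) or `2 p + 1` (for `true`). -/
def pairIndex {m : ℕ} (q : Fin m × Bool) : Fin (m + m) :=
  ⟨2 * q.1 + if q.2 then 1 else 0, by have := q.1.2; split_ifs <;> omega⟩

lemma pairIndex_injective {m : ℕ} : Function.Injective (pairIndex (m := m)) := by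
  rintro ⟨p, b⟩ ⟨q, c⟩ h
  simp only [pairIndex, Fin.mk.injEq] at h
  cases b <;> cases c <;> simp [Fin.ext_iff] at h ⊢ <;> omega

lemma sqBounded_barExt {E n : ℕ} {D : ℝ} (hD : 0 ≤ D) {Sbar : Fin E → Matrix (Fin n) (Fin n) ℝ}
    (hS : ∀ e, specNorm (Sbar e) ^ 2 ≤ D) (e : ℕ) : SqBounded D (barExt Sbar e) := by
  unfold barExt
  split_ifs with h
  · exact sqBounded_of_specNorm (hS _)
  · intro v
    simp only [Matrix.zero_mulVec, Pi.zero_apply, ne_eq, OfNat.ofNat_ne_zero, not_false_eq_true,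
      zero_pow, Finset.sum_const_zero]
    positivity

lemma pertDiff_pairIndex {n m : ℕ} (Sbar : Fin (m + m) → Matrix (Fin n) (Fin n) ℝ)
    (g : Fin (m + m) → Fin n → Fin n → ℝ) (p : Fin m) :
    pertDiff pairIndex (fun p : Fin m => barExt Sbar (2 * p) - barExt Sbar (2 * p + 1)) g p =
      smoothedCov Sbar g (2 * p) - smoothedCov Sbar g (2 * p + 1) := by
  have h1 : 2 * (p : ℕ) < m + m := by omega
  have h2 : 2 * (p : ℕ) + 1 < m + m := by omega
  simp only [pertDiff, barExt, smoothedCov, dif_pos h1, dif_pos h2, pairIndex, if_true,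
    Bool.false_eq_true, if_false, add_zero]
  abel

lemma offDiagEnergy_nonneg {k n m : ℕ} (Δ : Fin m → Matrix (Fin n) (Fin n) ℝ)
    (Q : Matrix (Fin k) (Fin n) ℝ) : 0 ≤ offDiagEnergy Δ Q := by
  refine Finset.sum_nonneg fun p _ => Finset.sum_nonneg fun i _ => Finset.sum_nonneg fun j _ => ?_
  split_ifs <;> positivity

lemma gaussMatrices_not_forall_lt_offDiagEnergy_le_two_mul_exp {k n m : ℕ} {D : ℝ} (hk : 2 ≤ k)
    (hkn : 2 * k ≤ n) (hD : 0 < D)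
    (hE : 200000 * (((n : ℝ) - k) / ((k : ℝ) - 1)) *
      max 1 (max (Real.log (D / (((k : ℝ) - 1) * n))) (Real.log ((n : ℝ) / ((k : ℝ) - 1)))) <
        ((m + m : ℕ) : ℝ))
    (hEn : ((m + m : ℕ) : ℝ) ≤ n)
    {Δ : Fin m → Matrix (Fin n) (Fin n) ℝ} (hΔ : ∀ p, SqBounded (4 * D) (Δ p)) :
    gaussMatrices (m + m) n {g | ¬ ∀ Q : Matrix (Fin k) (Fin n) ℝ, Q * Qᵀ = 1 →
      1 / 3084 * (offDiagEnergy Δ Q + m * (k * (k - 1) * n)) <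
        offDiagEnergy (pertDiff pairIndex Δ g) Q} ≤
    ENNReal.ofReal (2 * Real.exp (-n)) := by
  set M := max 1 (max (Real.log (D / (((k : ℝ) - 1) * n))) (Real.log ((n : ℝ) / ((k : ℝ) - 1))))
  have hM : 1 ≤ M := le_max_left _ _
  have hk2 : (2 : ℝ) ≤ k := by exact_mod_cast hk
  have hkn2 : 2 * (k : ℝ) ≤ n := by exact_mod_cast hkn
  have ha : (0 : ℝ) < k - 1 := by linarith
  have hn : (0 : ℝ) < n := by linarith
  have hDM : D ≤ (k - 1) * n * Real.exp M := by
    have h1 : Real.log (D / (((k : ℝ) - 1) * n)) ≤ M :=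
      (le_max_left _ _).trans (le_max_right _ _)
    rw [Real.log_le_iff_le_exp (by positivity), div_le_iff₀ (by positivity)] at h1
    linarith
  have hnM : (n : ℝ) ≤ (k - 1) * Real.exp M := by
    have h1 : Real.log ((n : ℝ) / ((k : ℝ) - 1)) ≤ M :=
      (le_max_right _ _).trans (le_max_right _ _)
    rw [Real.log_le_iff_le_exp (by positivity), div_le_iff₀ (by positivity)] at h1
    linarith
  have hmM : 100000 * (n * M) ≤ ((m : ℝ) + m) * (k - 1) := by
    have h1 : 200000 * (((n : ℝ) - k) / ((k : ℝ) - 1)) * M =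
        200000 * (n - k) * M / (k - 1) := by ring
    rw [h1, div_lt_iff₀ ha] at hE
    push_cast at hE
    nlinarith
  refine (gaussMatrices_not_forall_lt_offDiagEnergy_le (by omega) (by omega) pairIndex_injective
    hD.le hΔ (Real.exp_pos (-(12 * M))) ?_).trans (ENNReal.ofReal_le_ofReal ?_)
  · have := mul_le_mul_of_nonneg_left (net_resolution_le ha hn hM hDM hnM)
      (by linarith : (0 : ℝ) ≤ k)
    calc _ = k * (8 * (D + (64 * n) ^ 2) * Real.exp (-(12 * M)) ^ 2) := by ring
      _ ≤ _ := this
      _ = _ := by ring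
  · have h1 := natCast_mul_exp_neg_le hEn
    have h2 := net_card_mul_exp_le (k := k) (n := n) (M := M)
      (r := 1 / 3084 * (m * (k * (k - 1)))) (by omega) hM (by
        have := mul_le_mul_of_nonneg_left hmM (by linarith : (0 : ℝ) ≤ k)
        have h0 : 0 ≤ (k : ℝ) * n * M := by positivity
        nlinarith)
    linarith

lemma one_sub_le_toReal_of_measure_compl_le {Ω : Type*} [MeasurableSpace Ω] {μ : Measure Ω}
    [IsProbabilityMeasure μ] {s : Set Ω} {δ : ℝ} (hδ : 0 ≤ δ) (h : μ sᶜ ≤ ENNReal.ofReal δ) :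
    1 - δ ≤ (μ s).toReal := by
  have h1 : (1 : ENNReal) ≤ μ s + ENNReal.ofReal δ := by
    calc (1 : ENNReal) = μ (s ∪ sᶜ) := by rw [Set.union_compl_self, measure_univ]
      _ ≤ μ s + μ sᶜ := measure_union_le _ _
      _ ≤ _ := by gcongr
  have h2 := ENNReal.toReal_mono (by finiteness) h1
  rw [ENNReal.toReal_add (measure_ne_top _ _) ENNReal.ofReal_ne_top, ENNReal.toReal_ofReal hδ,
    ENNReal.toReal_one] at h2
  linarith

end Auxiliary

/-- Covariance-matching lower bound (main lemma): there are constants `c_1, c_2, b_1, b_2 > 0`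
such that for all `2 ≤ k ≤ d_s/2`, `D > 0`, and even `E` in the stated range, for any fixed
`Σ̄^e` with `max_e ‖Σ̄^e‖₂² ≤ D`, with probability at least `1 − c_1 exp(−d_s)` over the
Gaussian perturbations, simultaneously for every orthonormal `Q ∈ ℝ^{k×d_s}`,
`Σ_{odd e<E} Σ_{i≠j} (q_iᵀ Δ^e q_j)² > c_2 (A(Q) + E k (k−1) d_s)` where
`Δ^e = Σ_2^e − Σ_2^{e+1}` (pairs indexed here as `(2p, 2p+1)` for `p < E/2`). -/
theorem covariance_matching_lower_bound :
    ∃ c1 c2 b1 b2 : ℝ, 0 < c1 ∧ 0 < c2 ∧ 0 < b1 ∧ 0 < b2 ∧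
      ∀ (ds k E : ℕ) (D : ℝ), 2 ≤ k → 2 * k ≤ ds → 0 < D → Even E →
        b1 * (((ds : ℝ) - k) / ((k : ℝ) - 1)) *
            max 1 (max (Real.log (D / (((k : ℝ) - 1) * ds)))
              (Real.log ((ds : ℝ) / ((k : ℝ) - 1)))) < E →
        (E : ℝ) < b2 * ds →
        ∀ Sbar : Fin E → Matrix (Fin ds) (Fin ds) ℝ,
          (∀ e, specNorm (Sbar e) ^ 2 ≤ D) →
          1 - c1 * Real.exp (-(ds : ℝ)) ≤
            (gaussMatrices E ds
              {g | ∀ Q : Matrix (Fin k) (Fin ds) ℝ, Q * Qᵀ = 1 →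
                c2 * ((∑ p ∈ Finset.range (E / 2), ∑ i : Fin k, ∑ j : Fin k,
                        if i = j then 0 else
                          (Q i ⬝ᵥ ((barExt Sbar (2 * p) - barExt Sbar (2 * p + 1)) *ᵥ Q j)) ^ 2)
                      + (E : ℝ) * k * ((k : ℝ) - 1) * ds) <
                  ∑ p ∈ Finset.range (E / 2), ∑ i : Fin k, ∑ j : Fin k,
                    if i = j then 0 else
                      (Q i ⬝ᵥ ((smoothedCov Sbar g (2 * p) -
                        smoothedCov Sbar g (2 * p + 1)) *ᵥ Q j)) ^ 2}).toReal := by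
  refine ⟨2, 1 / 6168, 200000, 1, by norm_num, by norm_num, by norm_num, by norm_num, ?_⟩
  rintro n k E D hk hkn hD ⟨m, rfl⟩ hE hEn Sbar hS
  have := isProbabilityMeasure_gaussMatrices (m + m) n
  refine one_sub_le_toReal_of_measure_compl_le (by positivity) ?_
  refine le_trans (measure_mono ?_) (gaussMatrices_not_forall_lt_offDiagEnergy_le_two_mul_exp hk
    hkn hD hE (by linarith)
    (Δ := fun p : Fin m => barExt Sbar (2 * p) - barExt Sbar (2 * p + 1)) fun p => by
      have := (sqBounded_barExt hD.le hS (2 * p)).sub (sqBounded_barExt hD.le hS (2 * p + 1))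
      rwa [show 2 * D + 2 * D = 4 * D by ring] at this)
  intro g hg hcon
  refine hg fun Q hQ => ?_
  have h := hcon Q hQ
  have h0 := offDiagEnergy_nonneg
    (fun p : Fin m => barExt Sbar (2 * p) - barExt Sbar (2 * p + 1)) Q
  simp only [offDiagEnergy, pertDiff_pairIndex] at h h0
  rw [show (m + m) / 2 = m by omega, Finset.sum_range, Finset.sum_range]
  refine lt_of_le_of_lt ?_ h
  push_cast
  linarith
end

section
/- Let d_s ≥ 1, let P ∈ ℝ^{2×d_s} satisfy P Pᵀ = I_2, and let Σ̄^1, Σ̄^2, Σ̄^3 ∈ ℝ^{d_s×d_s} be fixed matrices. Let G_1, G_2, G_3 be independent random d_s×d_s matrices with i.i.d. N(0,1) entries, and set Σ = (Σ̄^1 − Σ̄^2) + G_1 G_1ᵀ − G_2 G_2ᵀ and Σ' = (Σ̄^1 − Σ̄^3) + G_1 G_1ᵀ − G_3 G_3ᵀ. Then almost surely there is no q ∈ ℝ² with ‖q‖_2 = 1 satisfying both qᵀ P Σ Pᵀ q = 0 and qᵀ P Σ' Pᵀ q = 0. -/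
open Matrix MeasureTheory

/-- A measurable set whose sections along one coordinate are null is null for the product. -/
theorem pi_null_of_sections_null {ι : Type*} [Fintype ι] [DecidableEq ι] {X : ι → Type*}
    [∀ i, MeasurableSpace (X i)] (μ : ∀ i, Measure (X i)) [∀ i, SigmaFinite (μ i)]
    {s : Set (∀ i, X i)} (hs : MeasurableSet s) (i : ι)
    (h : ∀ x, μ i {y | Function.update x i y ∈ s} = 0) : Measure.pi μ s = 0 := by
  rcases isEmpty_or_nonempty (∀ i, X i) with he | ⟨⟨x₀⟩⟩
  · rw [Set.eq_empty_of_isEmpty s, measure_empty]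
  have hf : Measurable (s.indicator (1 : (∀ i, X i) → ENNReal)) := measurable_one.indicator hs
  rw [← lintegral_indicator_one hs, lintegral_eq_lmarginal_univ x₀,
    lmarginal_erase' _ hf (Finset.mem_univ i)]
  have h0 : (fun x => ∫⁻ y, s.indicator (1 : (∀ i, X i) → ENNReal) (Function.update x i y) ∂μ i)
      = fun _ => 0 := by
    funext x
    have hm : MeasurableSet {y | Function.update x i y ∈ s} := measurable_update x hs
    rw [← h x, ← lintegral_indicator_one hm]
    rfl
  rw [h0]
  simp [lmarginal]

/-- The law of an `m × n` matrix with i.i.d. standard Gaussian entries charges no level set of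
`M ↦ ‖Mᵀ v‖²`, for `v ≠ 0`. -/
theorem pi_gaussianReal_sum_sq_eq_null {m n : Type*} [Fintype m] [Fintype n] [Nonempty n]
    {v : m → ℝ} (hv : v ≠ 0) (c : ℝ) :
    (Measure.pi fun _ : m => Measure.pi fun _ : n => ProbabilityTheory.gaussianReal 0 1)
      {M | ∑ k, (∑ i, v i * M i k) ^ 2 = c} = 0 := by
  classical
  obtain ⟨i, hi⟩ := Function.ne_iff.mp hv
  have hi : v i ≠ 0 := hi
  obtain ⟨k⟩ := ‹Nonempty n›
  have hs : MeasurableSet {M : m → n → ℝ | ∑ k, (∑ i, v i * M i k) ^ 2 = c} :=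
    measurableSet_eq_fun (by fun_prop) measurable_const
  refine pi_null_of_sections_null _ hs i fun M => ?_
  refine pi_null_of_sections_null _ (measurable_update M hs) k fun r => ?_
  have := ProbabilityTheory.nullSingletonClass_gaussianReal (μ := 0) (v := 1) one_ne_zero
  set α := ∑ i' ∈ Finset.univ.erase i, v i' * M i' k
  set β := c - ∑ k' ∈ Finset.univ.erase k,
    (v i * r k' + ∑ i' ∈ Finset.univ.erase i, v i' * M i' k') ^ 2
  refine (Set.Finite.subset (Set.toFinite {(√β - α) / v i, (-√β - α) / v i})
    fun y hy => ?_).measure_zero _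
  have hy : ∑ k', (∑ i', v i' * Function.update M i (Function.update r k y) i' k') ^ 2 = c := hy
  have hcol : ∀ k', ∑ i', v i' * Function.update M i (Function.update r k y) i' k' =
      v i * Function.update r k y k' + ∑ i' ∈ Finset.univ.erase i, v i' * M i' k' := fun k' => by
    rw [← Finset.add_sum_erase _ _ (Finset.mem_univ i), Function.update_self]
    congr 1
    refine Finset.sum_congr rfl fun i' hi' => ?_
    rw [Function.update_of_ne (Finset.ne_of_mem_erase hi')]
  simp only [hcol] at hy
  have hrow : ∑ k' ∈ Finset.univ.erase k, (v i * Function.update r k y k' +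
      ∑ i' ∈ Finset.univ.erase i, v i' * M i' k') ^ 2 = c - β := by
    rw [sub_sub_cancel]
    refine Finset.sum_congr rfl fun k' hk' => ?_
    rw [Function.update_of_ne (Finset.ne_of_mem_erase hk')]
  rw [← Finset.add_sum_erase _ _ (Finset.mem_univ k), Function.update_self, hrow] at hy
  have hsq : (v i * y + α) ^ 2 = β := by linarith
  have habs : √β = |v i * y + α| := by rw [← hsq, Real.sqrt_sq_eq_abs]
  rw [Set.mem_insert_iff, Set.mem_singleton_iff, eq_div_iff hi, eq_div_iff hi]
  rcases abs_choice (v i * y + α) with h | h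
  · left; linarith
  · right; linarith

/-- If `v` and `c` do not depend on the `j`-th matrix and `v` does not vanish, then almost surely
`‖G_jᵀ v‖² ≠ c`. -/
theorem gaussMatrices_sum_sq_eq_null {E ds : ℕ} [NeZero ds] (j : Fin E)
    {v : (Fin E → Fin ds → Fin ds → ℝ) → Fin ds → ℝ} {c : (Fin E → Fin ds → Fin ds → ℝ) → ℝ}
    (hv : Measurable v) (hc : Measurable c) (hv0 : ∀ g, v g ≠ 0)
    (hvj : ∀ g M, v (Function.update g j M) = v g)
    (hcj : ∀ g M, c (Function.update g j M) = c g) :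
    gaussMatrices E ds {g | ∑ k, (∑ i, v g i * g j i k) ^ 2 = c g} = 0 := by
  refine pi_null_of_sections_null _ (measurableSet_eq_fun (by fun_prop) hc) j fun g => ?_
  simpa [hvj, hcj] using pi_gaussianReal_sum_sq_eq_null (n := Fin ds) (hv0 g) (c g)

theorem quadForm_projected_covariance_diff {m n : Type*} [Fintype m] [Fintype n]
    (P : Matrix m n ℝ) (S G H : Matrix n n ℝ) (q : m → ℝ) :
    q ⬝ᵥ ((P * (S + G * Gᵀ - H * Hᵀ) * Pᵀ) *ᵥ q) =
      ((q ᵥ* P) ⬝ᵥ (S *ᵥ (q ᵥ* P)) + ∑ k, (∑ i, (q ᵥ* P) i * G i k) ^ 2) -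
        ∑ k, (∑ i, (q ᵥ* P) i * H i k) ^ 2 := by
  have hsq : ∀ (w : n → ℝ) (M : Matrix n n ℝ),
      w ⬝ᵥ ((M * Mᵀ) *ᵥ w) = ∑ k, (∑ i, w i * M i k) ^ 2 := fun w M => by
    rw [← mulVec_mulVec, dotProduct_mulVec, mulVec_transpose]
    simp [dotProduct, vecMul, sq]
  rw [← mulVec_mulVec, ← mulVec_mulVec, mulVec_transpose, dotProduct_mulVec, sub_mulVec,
    add_mulVec, dotProduct_sub, dotProduct_add, hsq, hsq]

theorem dotProduct_mulVec_fin_two (A : Matrix (Fin 2) (Fin 2) ℝ) (q : Fin 2 → ℝ) :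
    q ⬝ᵥ (A *ᵥ q) = A 0 0 * q 0 ^ 2 + (A 0 1 + A 1 0) * (q 0 * q 1) + A 1 1 * q 1 ^ 2 := by
  simp [dotProduct, mulVec, Fin.sum_univ_two]
  ring

/-- A root of the binary quadratic form `q ↦ qᵀ A q` in the chart `q 1 = 1`, with the sign of the
square root of the discriminant given by `s`. -/
noncomputable def quadFormRoot (s : ℝ) (A : Matrix (Fin 2) (Fin 2) ℝ) : ℝ :=
  (-(A 0 1 + A 1 0) + s * √((A 0 1 + A 1 0) ^ 2 - 4 * A 0 0 * A 1 1)) / (2 * A 0 0)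

theorem eq_smul_quadFormRoot {A : Matrix (Fin 2) (Fin 2) ℝ} (hA : A 0 0 ≠ 0) {q : Fin 2 → ℝ}
    (hq : q ≠ 0) (h : q ⬝ᵥ (A *ᵥ q) = 0) :
    ∃ y : ℝ, y ≠ 0 ∧ (q = y • ![quadFormRoot 1 A, 1] ∨ q = y • ![quadFormRoot (-1) A, 1]) := by
  rw [dotProduct_mulVec_fin_two] at h
  have hy : q 1 ≠ 0 := fun hy => hq <| by
    have hx : q 0 = 0 := by simpa [hy, hA] using h
    ext i; fin_cases i <;> simp [hx, hy]
  refine ⟨q 1, hy, ?_⟩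
  set t := q 0 / q 1 with ht
  have hx : q 0 = q 1 * t := by rw [ht]; field_simp
  have hroot : A 0 0 * t ^ 2 + (A 0 1 + A 1 0) * t + A 1 1 = 0 := by
    have : q 1 ^ 2 * (A 0 0 * t ^ 2 + (A 0 1 + A 1 0) * t + A 1 1) = 0 := by
      rw [← h, hx]; ring
    simpa [hy] using this
  have hdisc : (A 0 1 + A 1 0) ^ 2 - 4 * A 0 0 * A 1 1 = (2 * A 0 0 * t + (A 0 1 + A 1 0)) ^ 2 := by
    linear_combination (-4 * A 0 0) * hroot
  have hchoice : t = quadFormRoot 1 A ∨ t = quadFormRoot (-1) A := by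
    unfold quadFormRoot
    rw [hdisc, Real.sqrt_sq_eq_abs, eq_div_iff (by simpa using hA), eq_div_iff (by simpa using hA)]
    rcases abs_choice (2 * A 0 0 * t + (A 0 1 + A 1 0)) with h | h <;> rw [h]
    · left; ring
    · right; ring
  refine hchoice.imp (fun h => ?_) fun h => ?_ <;>
    · ext i; fin_cases i <;> simp [← h, hx]

/-- Final round of IFM with two remaining spurious dimensions: for fixed `P ∈ ℝ^{2×d_s}` with
`P Pᵀ = I_2` and fixed `Σ̄^1, Σ̄^2, Σ̄^3`, setting `Σ = (Σ̄^1 − Σ̄^2) + G_1G_1ᵀ − G_2G_2ᵀ` and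
`Σ' = (Σ̄^1 − Σ̄^3) + G_1G_1ᵀ − G_3G_3ᵀ`, almost surely no unit vector `q ∈ ℝ²` satisfies
both `qᵀ P Σ Pᵀ q = 0` and `qᵀ P Σ' Pᵀ q = 0`. -/
theorem ifm_last_round_two_dims {ds : ℕ} (hds : 1 ≤ ds)
    (P : Matrix (Fin 2) (Fin ds) ℝ) (hP : P * Pᵀ = 1)
    (S1 S2 S3 : Matrix (Fin ds) (Fin ds) ℝ) :
    gaussMatrices 3 ds
      {g | ∃ q : Fin 2 → ℝ, Real.sqrt (∑ i, q i ^ 2) = 1 ∧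
        q ⬝ᵥ ((P * ((S1 - S2) + Matrix.of (g 0) * (Matrix.of (g 0))ᵀ -
          Matrix.of (g 1) * (Matrix.of (g 1))ᵀ) * Pᵀ) *ᵥ q) = 0 ∧
        q ⬝ᵥ ((P * ((S1 - S3) + Matrix.of (g 0) * (Matrix.of (g 0))ᵀ -
          Matrix.of (g 2) * (Matrix.of (g 2))ᵀ) * Pᵀ) *ᵥ q) = 0} = 0 := by
  have : NeZero ds := ⟨by lia⟩
  have hw : ∀ q : Fin 2 → ℝ, q ≠ 0 → q ᵥ* P ≠ 0 := fun q hq h => hq <| by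
    rw [← vecMul_one q, ← hP, ← vecMul_vecMul, h, zero_vecMul]
  set A : (Fin 3 → Fin ds → Fin ds → ℝ) → Matrix (Fin 2) (Fin 2) ℝ := fun g =>
    P * ((S1 - S2) + Matrix.of (g 0) * (Matrix.of (g 0))ᵀ -
      Matrix.of (g 1) * (Matrix.of (g 1))ᵀ) * Pᵀ with hA
  set B : (Fin 3 → Fin ds → Fin ds → ℝ) → Matrix (Fin 2) (Fin 2) ℝ := fun g =>
    P * ((S1 - S3) + Matrix.of (g 0) * (Matrix.of (g 0))ᵀ -
      Matrix.of (g 2) * (Matrix.of (g 2))ᵀ) * Pᵀ with hB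
  have hAm : ∀ i j, Measurable fun g => A g i j := fun i j => by
    simp only [hA, Matrix.mul_apply, Matrix.sub_apply, Matrix.add_apply, Matrix.transpose_apply,
      Matrix.of_apply]
    fun_prop
  have hlead : gaussMatrices 3 ds {g | A g 0 0 = 0} = 0 := by
    have h := gaussMatrices_sum_sq_eq_null (E := 3) (ds := ds) 1 (v := fun _ => ![1, 0] ᵥ* P)
      (c := fun g => (![1, 0] ᵥ* P) ⬝ᵥ ((S1 - S2) *ᵥ (![1, 0] ᵥ* P)) +
        ∑ k, (∑ i, (![1, 0] ᵥ* P) i * g 0 i k) ^ 2)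
      measurable_const (by fun_prop) (fun _ => hw _ (by simp)) (fun _ _ => rfl) (by simp)
    refine measure_mono_null (fun g hg => ?_) h
    have h0 : ![1, 0] ⬝ᵥ (A g *ᵥ ![1, 0]) = 0 := by
      rw [dotProduct_mulVec_fin_two]; simpa using hg
    rw [hA, quadForm_projected_covariance_diff, sub_eq_zero] at h0
    exact h0.symm
  have hroot : ∀ s : ℝ, gaussMatrices 3 ds
      {g | ![quadFormRoot s (A g), 1] ⬝ᵥ (B g *ᵥ ![quadFormRoot s (A g), 1]) = 0} = 0 := by
    intro s
    have hAj : ∀ g M, A (Function.update g 2 M) = A g := fun g M => by simp [hA]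
    have hrm : Measurable fun g => quadFormRoot s (A g) := by
      unfold quadFormRoot; fun_prop
    have hvm : Measurable fun g => ![quadFormRoot s (A g), 1] ᵥ* P := by
      refine measurable_pi_lambda _ fun i => ?_
      simp only [vecMul, dotProduct, Fin.sum_univ_two, cons_val_zero, cons_val_one]
      fun_prop
    have hcm : Measurable fun g : Fin 3 → Fin ds → Fin ds → ℝ =>
        (![quadFormRoot s (A g), 1] ᵥ* P) ⬝ᵥ ((S1 - S3) *ᵥ (![quadFormRoot s (A g), 1] ᵥ* P)) +
          ∑ k, (∑ i, (![quadFormRoot s (A g), 1] ᵥ* P) i * g 0 i k) ^ 2 := by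
      have hvi := fun i => (measurable_pi_apply i).comp hvm
      simp only [Function.comp_def] at hvi
      generalize (fun g => ![quadFormRoot s (A g), 1] ᵥ* P) = v at hvm hvi
      simp only [dotProduct, mulVec]
      fun_prop
    have h := gaussMatrices_sum_sq_eq_null 2 hvm hcm (fun _ => hw _ (by simp))
      (fun g M => by rw [hAj]) (fun g M => by simp [hAj])
    refine measure_mono_null (fun g hg => ?_) h
    have hg : ![quadFormRoot s (A g), 1] ⬝ᵥ (B g *ᵥ ![quadFormRoot s (A g), 1]) = 0 := hg
    rw [hB, quadForm_projected_covariance_diff, sub_eq_zero] at hg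
    exact hg.symm
  refine measure_mono_null ?_
    (measure_union_null hlead (measure_union_null (hroot 1) (hroot (-1))))
  rintro g ⟨q, hq, hqA, hqB⟩
  by_cases ha : A g 0 0 = 0
  · exact Or.inl ha
  have hq0 : q ≠ 0 := by rintro rfl; simp at hq
  obtain ⟨y, hy, h⟩ := eq_smul_quadFormRoot ha hq0 hqA
  refine Or.inr (h.imp (fun h => ?_) fun h => ?_) <;>
    simpa [h, mulVec_smul, hy, -cons_val_zero, -smul_cons] using hqB
end

section
/- Let b_1, …, b_d ∈ ℝ^d be linearly independent and let 0 < ℓ ≤ L. For each i ∈ {1,…,d}, let (A_i^{(k)})_{k≥1} be positive definite matrices with ℓ·I ⪯ A_i^{(k)} ⪯ L·I for all k and A_i^{(k)} → A_i as k → ∞. Suppose for each k there is x_k ≠ 0 with x_k ∈ ⋂_{i=1}^d E_{A_i^{(k)}, b_i}. Then: (i) ‖x_k‖_2 ≤ ‖b_1‖_2 / ℓ for all k; (ii) inf_k ‖x_k‖_2 > 0; and (iii) there is a subsequence of (x_k) converging to some x* ≠ 0 with x* ∈ ⋂_{i=1}^d E_{A_i, b_i}. -/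
open Matrix Filter

/-- A matrix with `ℓ • 1 ⪯ M` has quadratic form at least `ℓ ‖x‖²`. -/
lemma smul_sum_sq_le_dotProduct_mulVec {n : Type*} [Fintype n] [DecidableEq n]
    {M : Matrix n n ℝ} {ℓ : ℝ} (h : (M - ℓ • (1 : Matrix n n ℝ)).PosSemidef) (x : n → ℝ) :
    ℓ * ∑ j, x j ^ 2 ≤ x ⬝ᵥ (M *ᵥ x) := by
  have h := h.dotProduct_mulVec_nonneg x
  simp only [star_trivial, sub_mulVec, smul_mulVec, one_mulVec, dotProduct_sub, dotProduct_smul,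
    smul_eq_mul, sub_nonneg] at h
  simpa [dotProduct, ← sq] using h

/-- A matrix with `M ⪯ L • 1` has quadratic form at most `L ‖x‖²`. -/
lemma dotProduct_mulVec_le_smul_sum_sq {n : Type*} [Fintype n] [DecidableEq n]
    {M : Matrix n n ℝ} {L : ℝ} (h : (L • (1 : Matrix n n ℝ) - M).PosSemidef) (x : n → ℝ) :
    x ⬝ᵥ (M *ᵥ x) ≤ L * ∑ j, x j ^ 2 := by
  have h := h.dotProduct_mulVec_nonneg x
  simp only [star_trivial, sub_mulVec, smul_mulVec, one_mulVec, dotProduct_sub, dotProduct_smul,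
    smul_eq_mul, sub_nonneg] at h
  simpa [dotProduct, ← sq] using h

lemma sum_sq_pos_of_ne_zero {n : Type*} [Fintype n] {x : n → ℝ} (hx : x ≠ 0) :
    0 < ∑ j, x j ^ 2 := by
  obtain ⟨j, hj⟩ := Function.ne_iff.mp hx
  exact Finset.sum_pos' (fun i _ => sq_nonneg _) ⟨j, Finset.mem_univ j, sq_pos_of_ne_zero hj⟩

/-- A nonzero point of the ellipsoid `xᵀ M x = bᵀ x` has norm at most `‖b‖ / ℓ` if `ℓ • 1 ⪯ M`. -/
lemma sqrt_sum_sq_le_div_of_mem_ellipsoid {n : Type*} [Fintype n] [DecidableEq n]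
    {M : Matrix n n ℝ} {ℓ : ℝ} (hℓ : 0 < ℓ) (h : (M - ℓ • (1 : Matrix n n ℝ)).PosSemidef)
    {b x : n → ℝ} (hx : x ≠ 0) (hxE : x ⬝ᵥ (M *ᵥ x) = b ⬝ᵥ x) :
    √(∑ j, x j ^ 2) ≤ √(∑ j, b j ^ 2) / ℓ := by
  have hpos := sum_sq_pos_of_ne_zero hx
  have hlow : ℓ * √(∑ j, x j ^ 2) ^ 2 ≤ √(∑ j, b j ^ 2) * √(∑ j, x j ^ 2) := by
    rw [Real.sq_sqrt hpos.le]
    exact ((smul_sum_sq_le_dotProduct_mulVec h x).trans_eq hxE).trans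
      (Real.sum_mul_le_sqrt_mul_sqrt _ _ _)
  rw [le_div_iff₀ hℓ]
  have hs := Real.sqrt_pos.mpr hpos
  nlinarith

/-- The values of linearly independent functionals `b i` control the Euclidean norm. -/
lemma exists_sum_sq_le_mul_sum_dotProduct_sq {n : Type*} [Fintype n] [DecidableEq n]
    {b : n → n → ℝ} (hb : LinearIndependent ℝ b) :
    ∃ K : ℝ, 0 ≤ K ∧ ∀ x : n → ℝ, ∑ j, x j ^ 2 ≤ K * ∑ i, (b i ⬝ᵥ x) ^ 2 := by
  let B : Matrix n n ℝ := Matrix.of b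
  have hB : IsUnit B := Matrix.linearIndependent_rows_iff_isUnit.mp hb
  refine ⟨∑ j, ∑ i, B⁻¹ j i ^ 2, by positivity, fun x => ?_⟩
  have hx : B⁻¹ *ᵥ (B *ᵥ x) = x := by
    rw [mulVec_mulVec, nonsing_inv_mul _ ((isUnit_iff_isUnit_det B).mp hB), one_mulVec]
  rw [Finset.sum_mul]
  refine Finset.sum_le_sum fun j _ => ?_
  calc x j ^ 2 = (∑ i, B⁻¹ j i * (b i ⬝ᵥ x)) ^ 2 := by
        rw [← congrFun hx j]; rfl
    _ ≤ _ := Finset.sum_mul_sq_le_sq_mul_sq _ _ _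

/-- If `ℓ • 1 ⪯ M i ⪯ L • 1` and the `b i` are linearly independent, the nonzero common points of
the ellipsoids `xᵀ (M i) x = (b i)ᵀ x` are bounded away from the origin, uniformly in `M`. -/
lemma exists_pos_le_sqrt_sum_sq {n : Type*} [Fintype n] [DecidableEq n]
    {b : n → n → ℝ} (hb : LinearIndependent ℝ b) {ℓ : ℝ} (hℓ : 0 < ℓ) (L : ℝ) :
    ∃ m : ℝ, 0 < m ∧ ∀ (M : n → Matrix n n ℝ) (x : n → ℝ),
      (∀ i, (M i - ℓ • (1 : Matrix n n ℝ)).PosSemidef) →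
      (∀ i, (L • (1 : Matrix n n ℝ) - M i).PosSemidef) → x ≠ 0 →
      (∀ i, x ⬝ᵥ (M i *ᵥ x) = b i ⬝ᵥ x) → m ≤ √(∑ j, x j ^ 2) := by
  obtain ⟨K, hK, hKx⟩ := exists_sum_sq_le_mul_sum_dotProduct_sq hb
  set C : ℝ := K * (Fintype.card n * L ^ 2) + 1 with hC
  have hCpos : 0 < C := by positivity
  refine ⟨√(1 / C), Real.sqrt_pos.mpr (by positivity), fun M x hlow hup hx hxE => ?_⟩
  have hpos := sum_sq_pos_of_ne_zero hx
  refine Real.sqrt_le_sqrt ?_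
  rw [div_le_iff₀ hCpos]
  set S := ∑ j, x j ^ 2 with hS
  have hterm : ∀ i, (b i ⬝ᵥ x) ^ 2 ≤ (L * S) ^ 2 := fun i => by
    have h0 : 0 ≤ b i ⬝ᵥ x :=
      (by positivity : 0 ≤ ℓ * S).trans
        ((smul_sum_sq_le_dotProduct_mulVec (hlow i) x).trans_eq (hxE i))
    exact pow_le_pow_left₀ h0 ((hxE i).symm.trans_le (dotProduct_mulVec_le_smul_sum_sq (hup i) x)) 2
  have hsum : ∑ i, (b i ⬝ᵥ x) ^ 2 ≤ Fintype.card n * (L * S) ^ 2 := by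
    simpa using Finset.sum_le_sum fun i (_ : i ∈ Finset.univ) => hterm i
  have hle : S * 1 ≤ S * (K * (Fintype.card n * L ^ 2) * S) :=
    calc S * 1 = S := mul_one S
      _ ≤ K * (Fintype.card n * (L * S) ^ 2) := (hKx x).trans (mul_le_mul_of_nonneg_left hsum hK)
      _ = _ := by ring
  have := le_of_mul_le_mul_left hle hpos
  rw [hC]
  linarith

/-- Continuity/compactness step for the ellipsoid intersection theorem: given linearly
independent `b_1, …, b_d`, positive definite matrices `A_i^{(k)}` with
`ℓ·I ⪯ A_i^{(k)} ⪯ L·I` converging to `A_i`, and nonzero points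
`x_k ∈ ⋂_i E_{A_i^{(k)}, b_i}`, we have (i) `‖x_k‖₂ ≤ ‖b_1‖₂/ℓ`, (ii) `inf_k ‖x_k‖₂ > 0`,
and (iii) a subsequence of `(x_k)` converges to some nonzero `x* ∈ ⋂_i E_{A_i, b_i}`. -/
theorem ellipsoid_intersection_limit {d : ℕ} (hd : 0 < d)
    (b : Fin d → (Fin d → ℝ)) (hb : LinearIndependent ℝ b)
    (ℓ L : ℝ) (hℓ : 0 < ℓ) (hℓL : ℓ ≤ L)
    (A : Fin d → ℕ → Matrix (Fin d) (Fin d) ℝ)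
    (Alim : Fin d → Matrix (Fin d) (Fin d) ℝ)
    (hPD : ∀ i k, (A i k).PosDef)
    (hlow : ∀ i k, (A i k - ℓ • (1 : Matrix (Fin d) (Fin d) ℝ)).PosSemidef)
    (hup : ∀ i k, (L • (1 : Matrix (Fin d) (Fin d) ℝ) - A i k).PosSemidef)
    (hconv : ∀ i, Tendsto (fun k => A i k) atTop (nhds (Alim i)))
    (x : ℕ → (Fin d → ℝ)) (hx0 : ∀ k, x k ≠ 0)
    (hxE : ∀ k i, (x k) ⬝ᵥ ((A i k) *ᵥ x k) = (b i) ⬝ᵥ x k) :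
    (∀ k, Real.sqrt (∑ j, x k j ^ 2) ≤ Real.sqrt (∑ j, b ⟨0, hd⟩ j ^ 2) / ℓ) ∧
    (∃ m : ℝ, 0 < m ∧ ∀ k, m ≤ Real.sqrt (∑ j, x k j ^ 2)) ∧
    (∃ (φ : ℕ → ℕ) (xstar : Fin d → ℝ), StrictMono φ ∧ xstar ≠ 0 ∧
      Tendsto (x ∘ φ) atTop (nhds xstar) ∧
      ∀ i, xstar ⬝ᵥ ((Alim i) *ᵥ xstar) = (b i) ⬝ᵥ xstar) := by
  have hbound : ∀ k, √(∑ j, x k j ^ 2) ≤ √(∑ j, b ⟨0, hd⟩ j ^ 2) / ℓ := fun k =>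
    sqrt_sum_sq_le_div_of_mem_ellipsoid hℓ (hlow _ k) (hx0 k) (hxE k _)
  obtain ⟨m, hm, hmx⟩ := exists_pos_le_sqrt_sum_sq hb hℓ L
  have hmle : ∀ k, m ≤ √(∑ j, x k j ^ 2) := fun k =>
    hmx (fun i => A i k) (x k) (fun i => hlow i k) (fun i => hup i k) (hx0 k) (hxE k)
  refine ⟨hbound, ⟨m, hm, hmle⟩, ?_⟩
  have hmem : ∀ k, x k ∈ Metric.closedBall (0 : Fin d → ℝ) (√(∑ j, b ⟨0, hd⟩ j ^ 2) / ℓ) :=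
    fun k => by
      rw [mem_closedBall_zero_iff, pi_norm_le_iff_of_nonneg (by positivity)]
      intro j
      refine le_trans ?_ (hbound k)
      exact Real.abs_le_sqrt
        (Finset.single_le_sum (fun i _ => sq_nonneg (x k i)) (Finset.mem_univ j))
  obtain ⟨y, -, φ, hφ, hy⟩ := (isCompact_closedBall _ _).tendsto_subseq hmem
  refine ⟨φ, y, hφ, ?_, hy, fun i => ?_⟩
  · rintro rfl
    have hcont : Continuous fun z : Fin d → ℝ => √(∑ j, z j ^ 2) := by fun_prop
    have := ge_of_tendsto' ((hcont.tendsto _).comp hy) fun k => hmle (φ k)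
    simp only [Pi.zero_apply, ne_eq, OfNat.ofNat_ne_zero, not_false_eq_true, zero_pow,
      Finset.sum_const_zero, Real.sqrt_zero] at this
    exact hm.not_ge this
  · have hquad : Continuous fun p : Matrix (Fin d) (Fin d) ℝ × (Fin d → ℝ) =>
        p.2 ⬝ᵥ (p.1 *ᵥ p.2) := by fun_prop
    have hlin : Continuous fun z : Fin d → ℝ => b i ⬝ᵥ z := by fun_prop
    have hA := (hconv i).comp hφ.tendsto_atTop
    refine tendsto_nhds_unique ((hquad.tendsto (Alim i, y)).comp (hA.prodMk_nhds hy)) ?_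
    refine ((hlin.tendsto y).comp hy).congr fun k => ?_
    exact (hxE (φ k) i).symm
end
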